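/- Let k = 3. The map EP : N → C(Δ), sending n to the set of extreme points of DF(n) (a nonempty compact subset of Δ, since DF(n) is a compact convex set lying in a plane), is discontinuous at n ∈ N if and only if either n is of finite type or n ∈ ℕ^ℕ is exceptional (Φ^{-1}(n) is not a singleton). -/

import Mathlib

open Filter Topology
open scoped Classical

namespace BetaDF

/-- Digit sequences (elements of `Σ = {0,…,k−1}^ℕ` when all entries are `< k`). -/
abbrev Seq : Type := ℕ → ℕ

/-- Lexicographic (strict) order on digit sequences. -/
def seqLt (v w : Seq) : Prop := ∃ r, (∀ s, s < r → v s = w s) ∧ v r < w r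

/-- Lexicographic order on digit sequences. -/
def seqLe (v w : Seq) : Prop := seqLt v w ∨ v = w

/-- The shift map `σ`. -/
def shift (w : Seq) : Seq := fun r => w (r + 1)

/-- Membership in `Σ = {0,…,k−1}^ℕ`. -/
def InSigma (k : ℕ) (w : Seq) : Prop := ∀ r, w r < k

/-- A sequence is maximal if it is `≥` every element of its shift orbit. -/
def IsMaximal (w : Seq) : Prop := ∀ r, seqLe (shift^[r] w) w

/-- Number of occurrences of the digit `i` among the first `r` entries of `w`. -/
def digitCount (w : Seq) (i r : ℕ) : ℕ := ((Finset.range r).filter fun s => w s = i).card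

/-- The ambient Euclidean space `ℝ^k`. -/
abbrev E (k : ℕ) : Type := EuclideanSpace ℝ (Fin k)

/-- The `i`-th coordinate (with junk value `0` for `i ≥ k`). -/
def proj {k : ℕ} (α : E k) (i : ℕ) : ℝ := if h : i < k then α ⟨i, h⟩ else 0

/-- `w` has digit frequency vector `α`. -/
def HasDigitFreq (k : ℕ) (w : Seq) (α : E k) : Prop :=
  ∀ i, i < k →
    Tendsto (fun r => (digitCount w i r : ℝ) / (r : ℝ)) atTop (𝓝 (proj α i))

/-- The standard `(k−1)`-simplex `Δ`. -/
def simplex (k : ℕ) : Set (E k) := {α | (∀ i : Fin k, 0 ≤ α i) ∧ ∑ i, α i = 1}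

/-- The face `F = {α ∈ Δ : α_{k−1} = 0}`. -/
def faceF (k : ℕ) : Set (E k) := {α ∈ simplex k | proj α (k - 1) = 0}

/-- `Δ' = Δ ∖ F`. -/
def simplex' (k : ℕ) : Set (E k) := simplex k \ faceF k

/-- `J(α) = ⌊α₀/α_{k−1}⌋`. -/
noncomputable def Jfun {k : ℕ} (α : E k) : ℕ := ⌊proj α 0 / proj α (k - 1)⌋₊

/-- The map `K_n`. -/
noncomputable def Kmap {k : ℕ} (n : ℕ) (α : E k) : E k :=
  (WithLp.equiv 2 (Fin k → ℝ)).symm fun i =>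
    if (i : ℕ) + 2 < k then proj α ((i : ℕ) + 1) / (1 - proj α 0)
    else if (i : ℕ) + 2 = k then (proj α 0 - n * proj α (k - 1)) / (1 - proj α 0)
    else ((n + 1) * proj α (k - 1) - proj α 0) / (1 - proj α 0)

/-- The continued-fraction map `K : Δ' → Δ'`, `K(α) = K_{J(α)}(α)`. -/
noncomputable def Kstep {k : ℕ} (α : E k) : E k := Kmap (Jfun α) α

/-- The itinerary map `Φ(α)_r = J(K^r(α))`. -/
noncomputable def Phi {k : ℕ} (α : E k) : ℕ → ℕ := fun r => Jfun (Kstep^[r] α)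

/-- The projective embedding `K_n^{-1} : Δ → Δ`. -/
noncomputable def Kinv {k : ℕ} (n : ℕ) (α : E k) : E k :=
  (WithLp.equiv 2 (Fin k → ℝ)).symm fun i =>
    (if (i : ℕ) = 0 then (n + 1) * proj α (k - 2) + n * proj α (k - 1)
      else if (i : ℕ) + 1 = k then proj α (k - 2) + proj α (k - 1)
      else proj α ((i : ℕ) - 1)) /
      ((n + 1) * proj α (k - 2) + n * proj α (k - 1) + 1)

/-- `Υ_{n,r} = K_{n₀}^{-1} ∘ ⋯ ∘ K_{n_r}^{-1}`. -/
noncomputable def Ups {k : ℕ} (n : ℕ → ℕ) : ℕ → E k → E k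
  | 0 => Kinv (n 0)
  | r + 1 => fun α => Ups n r (Kinv (n (r + 1)) α)

/-- `A_{n,r} = Υ_{n,r}(Δ)`. -/
noncomputable def Anr (k : ℕ) (n : ℕ → ℕ) (r : ℕ) : Set (E k) := Ups n r '' simplex k

/-- `F_{n,r} = Υ_{n,r}(F)`. -/
noncomputable def Fnr (k : ℕ) (n : ℕ → ℕ) (r : ℕ) : Set (E k) := Ups n r '' faceF k

/-- Reverse-lexicographic strict order on `ℕ^ℕ`: `a < b` iff `a` exceeds `b`
at the first index where they differ. -/
def revLexLt (a b : ℕ → ℕ) : Prop := ∃ r, (∀ s, s < r → a s = b s) ∧ b r < a r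

/-- The word to which the substitution `Λ_n` sends the digit `i`. -/
def lamWord (k n i : ℕ) : List ℕ :=
  if i + 2 < k then [i + 1]
  else if i + 2 = k then (k - 1) :: List.replicate (n + 1) 0
  else (k - 1) :: List.replicate n 0

/-- The substitution `Λ_n : Σ → Σ`. -/
def lamSub (k n : ℕ) (w : Seq) : Seq := fun m =>
  (((List.range (m + 1)).map fun r => lamWord k n (w r)).flatten).getD m 0

/-- `Λ_{n,r} = Λ_{n₀} ∘ ⋯ ∘ Λ_{n_r}`. -/
def lamChain (k : ℕ) (n : ℕ → ℕ) : ℕ → Seq → Seq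
  | 0 => lamSub k (n 0)
  | r + 1 => fun w => lamChain k n r (lamSub k (n (r + 1)) w)

/-- `Λ_{n₀} ∘ ⋯ ∘ Λ_{n_{R−1}}` for a finite list of indices. -/
def lamList (k : ℕ) : List ℕ → Seq → Seq
  | [], w => w
  | a :: t, w => lamSub k a (lamList k t w)

/-- The constant sequence `(k−1)(k−1)(k−1)…`. -/
def topSeq (k : ℕ) : Seq := fun _ => k - 1

/-- The sequence `(k−1)000…`. -/
def baseSeq (k : ℕ) : Seq := fun m => if m = 0 then k - 1 else 0

/-- `S(n) = lim_{r→∞} Λ_{n,r}((k−1)(k−1)(k−1)…)` (limit in the product topology). -/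
noncomputable def Sseq (k : ℕ) (n : ℕ → ℕ) : Seq :=
  limUnder atTop fun r => lamChain k n r (topSeq k)

/-- The compactified itinerary space `N`: sequences with values in `ℕ∞` such that
all entries from the first `∞` onwards equal `∞`.  Elements with no `∞` entry
correspond to `ℕ^ℕ`; the others are the finite type elements `n₀…n_{R−1}∞`. -/
def NN : Type := {m : ℕ → ℕ∞ // ∀ r, m r = ⊤ → m (r + 1) = ⊤}

/-- Reverse-lexicographic strict order on `N` (`∞` counts as larger than every natural). -/
def nnLt (m n : NN) : Prop := ∃ r, (∀ s, s < r → m.1 s = n.1 s) ∧ n.1 r < m.1 r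

/-- Reverse-lexicographic order on `N`. -/
def nnLe (m n : NN) : Prop := nnLt m n ∨ m = n

/-- The element of `N` determined by an element of `ℕ^ℕ`. -/
def toNN (g : ℕ → ℕ) : NN := ⟨fun r => (g r : ℕ∞), fun r h => absurd h (by simp)⟩

/-- The itinerary `n₀ … n_{R−1} (n_R + 1) 0 0 0 …` (of rational type). -/
def ratSeq (f : ℕ → ℕ) (R : ℕ) : ℕ → ℕ := fun r =>
  if r < R then f r else if r = R then f R + 1 else 0

/-- The finite type element `n₀ … n_{R−1} n_R ∞` of `N`. -/
def finNN (f : ℕ → ℕ) (R : ℕ) : NN :=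
  ⟨fun r => if r ≤ R then (f r : ℕ∞) else ⊤, by
    intro r h
    show (if r + 1 ≤ R then ((f (r + 1) : ℕ∞)) else ⊤) = ⊤
    have h' : (if r ≤ R then ((f r : ℕ∞)) else ⊤) = ⊤ := h
    by_cases h1 : r ≤ R
    · rw [if_pos h1] at h'
      exact absurd h' (by simp)
    · rw [if_neg (by omega : ¬ r + 1 ≤ R)]⟩

/-- The extension of `S` to `N`. -/
noncomputable def SN (k : ℕ) (m : NN) : Seq :=
  if h : ∃ R, m.1 R = ⊤ then
    lamList k ((List.range (Nat.find h)).map fun r => (m.1 r).toNat) (baseSeq k)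
  else Sseq k fun r => (m.1 r).toNat

/-- The metric `d(m,n) = 2^{−X(m,n)}` on `N`, where
`X(m,n) = r + min(m₀+⋯+m_r, n₀+⋯+n_r)` and `r` is the first index where `m,n` differ. -/
noncomputable def dN (m n : NN) : ℝ :=
  if h : m = n then 0
  else
    have hex : ∃ r, m.1 r ≠ n.1 r := by
      by_contra hc
      push_neg at hc
      exact h (Subtype.ext (funext hc))
    (2 : ℝ) ^ (-(((Nat.find hex : ℕ) : ℤ) +
      ((min (∑ s ∈ Finset.range (Nat.find hex + 1), m.1 s)
            (∑ s ∈ Finset.range (Nat.find hex + 1), n.1 s)).toNat : ℤ)))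

/-- The symbolic β-shift `X(w)`. -/
def Xset (k : ℕ) (w : Seq) : Set Seq :=
  {v | InSigma k v ∧ ∀ r, seqLe (shift^[r] v) w}

/-- The digit frequency set `DF(w)` of the symbolic β-shift `X(w)`. -/
def DFw (k : ℕ) (w : Seq) : Set (E k) :=
  {α | α ∈ simplex k ∧ ∃ v ∈ Xset k w, HasDigitFreq k v α}

/-- `DF(n) = DF(S(n))` for `n ∈ ℕ^ℕ`. -/
noncomputable def DFn (k : ℕ) (n : ℕ → ℕ) : Set (E k) := DFw k (Sseq k n)

/-- `DF(n) = DF(S(n))` for `n ∈ N`. -/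
noncomputable def DFN (k : ℕ) (m : NN) : Set (E k) := DFw k (SN k m)

/-- The infimax map `I = S ∘ Φ` on `Δ'`, extended by `I(α) = (k−1)000…` on `F`. -/
noncomputable def Ifun (k : ℕ) (α : E k) : Seq :=
  if α ∈ simplex' k then Sseq k (Phi α) else baseSeq k

/-- The simplex `T_m = {α ∈ Δ : (m+1)α_{k−1} ≤ α₀}`. -/
def Tset (k m : ℕ) : Set (E k) :=
  {α ∈ simplex k | ((m : ℝ) + 1) * proj α (k - 1) ≤ proj α 0}

/-- The standard basis vector `e_i`. -/
noncomputable def evec (k i : ℕ) : E k :=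
  (WithLp.equiv 2 (Fin k → ℝ)).symm fun j => if (j : ℕ) = i then 1 else 0

/-- The rational extreme points
`FE(n) = {Υ_{n,s}(e_{k−2}) : n_{s+t} ≠ 0 for some 1 ≤ t ≤ k−2}`. -/
noncomputable def FEset (k : ℕ) (n : ℕ → ℕ) : Set (E k) :=
  {α | ∃ s, (∃ t, 1 ≤ t ∧ t ≤ k - 2 ∧ n (s + t) ≠ 0) ∧ α = Ups n s (evec k (k - 2))}

/-- The set `E(n)` of non-trivial extreme points of `DF(n)`:
extreme points other than `e₀,…,e_{k−2}`. -/
noncomputable def Eset (k : ℕ) (n : ℕ → ℕ) : Set (E k) :=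
  Set.extremePoints ℝ (DFn k n) \ {α | ∃ i, i ≤ k - 2 ∧ α = evec k i}

/-- The fiber `Φ^{-1}(n) ⊆ Δ'`. -/
noncomputable def PhiFiber (k : ℕ) (n : ℕ → ℕ) : Set (E k) :=
  {α ∈ simplex' k | Phi α = n}

/-- `f_β(x) = βx mod 1`. -/
noncomputable def fbeta (β x : ℝ) : ℝ := Int.fract (β * x)

/-- The digit sequence of the greedy β-expansion of `x`: `d_β(x)_r = ⌊β f_β^r(x)⌋`. -/
noncomputable def dbeta (β : ℝ) (x : ℝ) : Seq := fun r => ⌊β * (fbeta β)^[r] x⌋₊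

/-- The digit frequency set `DF(β)` of β-expansions of points of `[0,1]`. -/
noncomputable def DFbeta (k : ℕ) (β : ℝ) : Set (E k) :=
  {α | α ∈ simplex k ∧ ∃ x ∈ Set.Icc (0 : ℝ) 1, HasDigitFreq k (dbeta β x) α}

/-- The sequence `w_β`: if `d_β(1) = d₁…d_{r−1}d_r000…` with `d_r > 0` then `w_β`
is the infinite repetition of `d₁…d_{r−1}(d_r − 1)`; otherwise `w_β = d_β(1)`. -/
noncomputable def wbeta (β : ℝ) : Seq :=
  if h : ∃ r, dbeta β 1 r ≠ 0 ∧ ∀ s, r < s → dbeta β 1 s = 0 then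
    fun m =>
      if m % (Nat.find h + 1) = Nat.find h then dbeta β 1 (Nat.find h) - 1
      else dbeta β 1 (m % (Nat.find h + 1))
  else dbeta β 1

/-- `DF` extended to `[k−1,k]` by `DF(k−1) = F` and `DF(k) = Δ`. -/
noncomputable def DFext (k : ℕ) (β : ℝ) : Set (E k) :=
  if β ≤ (k : ℝ) - 1 then faceF k
  else if (k : ℝ) ≤ β then simplex k
  else DFbeta k β

/-- The mode-locking interval `I_{n₀…n_R}` determined by the word `f 0, …, f R`. -/
noncomputable def Iint (k : ℕ) (f : ℕ → ℕ) (R : ℕ) : Set ℝ :=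
  {β | (k : ℝ) - 1 < β ∧ β < k ∧
    seqLe (Sseq k (ratSeq f R)) (wbeta β) ∧ seqLe (wbeta β) (SN k (finNN f R))}

/-- The frequency vector of the first `s` digits of `w`. -/
noncomputable def freqVec (k : ℕ) (w : Seq) (s : ℕ) : E k :=
  (WithLp.equiv 2 (Fin k → ℝ)).symm fun i => (digitCount w (i : ℕ) s : ℝ) / (s : ℝ)


/-! ### Concatenation of words -/

/-- Prepend a finite word to a sequence. -/
def app (l : List ℕ) (w : Seq) : Seq := fun i => if i < l.length then l.getD i 0 else w (i - l.length)

/-- Infinite concatenation of words. -/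
def concat (f : ℕ → List ℕ) : Seq := fun m => (((List.range (m + 1)).map f).flatten).getD m 0

lemma lamSub_eq_concat (k n : ℕ) (w : Seq) : lamSub k n w = concat fun r => lamWord k n (w r) := rfl

lemma flatten_len (f : ℕ → List ℕ) (hf : ∀ r, f r ≠ []) (K : ℕ) :
    K ≤ (((List.range K).map f).flatten).length := by
  induction K with
  | zero => simp
  | succ K ih =>
    rw [List.range_succ, List.map_append, List.flatten_append, List.length_append]
    have : 0 < (f K).length := List.length_pos_iff.mpr (hf K)
    simp only [List.map_cons, List.map_nil, List.flatten_cons, List.flatten_nil, List.append_nil]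
    omega

lemma concat_stable (f : ℕ → List ℕ) (hf : ∀ r, f r ≠ []) (j d : ℕ) :
    (((List.range (j + 1 + d)).map f).flatten).getD j 0 = concat f j := by
  induction d with
  | zero => rfl
  | succ d ih =>
    rw [← ih, ← Nat.add_assoc, List.range_succ, List.map_append, List.flatten_append,
      List.getD_append]
    have := flatten_len f hf (j + 1 + d)
    omega

lemma concat_eq (f : ℕ → List ℕ) (hf : ∀ r, f r ≠ []) :
    concat f = app (f 0) (concat fun r => f (r + 1)) := by
  funext m
  have h0 : 0 < (f 0).length := List.length_pos_iff.mpr (hf 0)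
  unfold app
  have e : (((List.range (m + 1)).map f).flatten) =
      f 0 ++ ((List.range m).map (fun r => f (r + 1))).flatten := by
    rw [List.range_succ_eq_map]
    simp [Function.comp_def]
  split_ifs with h
  · unfold concat
    rw [e, List.getD_append _ _ _ _ h]
  · have h2 : m = (m - (f 0).length) + 1 + ((f 0).length - 1) := by omega
    have := concat_stable (fun r => f (r + 1)) (fun r => hf _) (m - (f 0).length) ((f 0).length - 1)
    rw [← h2] at this
    rw [← this]
    unfold concat
    rw [e, List.getD_append_right _ _ _ _ (by omega)]

/-- Total length of the first `l` words. -/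
def blen (f : ℕ → List ℕ) (l : ℕ) : ℕ := ∑ t ∈ Finset.range l, (f t).length

lemma concat_pos (l : ℕ) : ∀ (f : ℕ → List ℕ) (_ : ∀ r, f r ≠ []) (j : ℕ) (_ : j < (f l).length),
    concat f (blen f l + j) = (f l).getD j 0 := by
  induction l with
  | zero =>
    intro f hf j hj
    rw [concat_eq f hf]
    simp [blen, app, hj]
  | succ l ih =>
    intro f hf j hj
    rw [concat_eq f hf]
    have e : blen f (l + 1) = (f 0).length + blen (fun r => f (r + 1)) l := by
      unfold blen; rw [Finset.sum_range_succ']; ring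
    unfold app
    rw [if_neg (by omega), ← ih (fun r => f (r + 1)) (fun r => hf _) j hj]
    congr 1; omega

abbrev V : Type := Fin 3 → ℝ

/-- Vector of digit counts of a prefix. -/
noncomputable def cnt (v : Seq) (i : ℕ) : V := fun d => (digitCount v d i : ℝ)

/-- Vector of digit counts of a word. -/
noncomputable def lc (u : List ℕ) : V := fun d => (u.count (d : ℕ) : ℝ)

lemma lc_append (u v : List ℕ) : lc (u ++ v) = lc u + lc v := by
  funext d; simp [lc]

lemma lc_nil : lc [] = 0 := by funext d; simp [lc]

lemma digitCount_succ (v : Seq) (d i : ℕ) :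
    digitCount v d (i + 1) = digitCount v d i + if v i = d then 1 else 0 := by
  unfold digitCount
  rw [Finset.range_add_one, Finset.filter_insert]
  split_ifs with h
  · rw [Finset.card_insert_of_notMem (by simp)]
  · rfl

lemma cnt_succ (v : Seq) (i : ℕ) : cnt v (i + 1) = cnt v i + lc [v i] := by
  funext d
  simp only [cnt, lc, Pi.add_apply, digitCount_succ, List.count_singleton]
  push_cast
  congr 1
  by_cases h : v i = (d : ℕ) <;> simp [h]

lemma cnt_zero (v : Seq) : cnt v 0 = 0 := by
  funext d; simp [cnt, digitCount]

lemma cnt_concat (f : ℕ → List ℕ) (hf : ∀ r, f r ≠ []) (l : ℕ) : ∀ j, j ≤ (f l).length →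
    cnt (concat f) (blen f l + j) = ∑ t ∈ Finset.range l, lc (f t) + lc ((f l).take j) := by
  induction l with
  | zero =>
    intro j
    induction j with
    | zero => intro _; simp [blen, cnt_zero, lc_nil]
    | succ j ih =>
      intro hj
      have := ih (by omega)
      rw [← Nat.add_assoc, cnt_succ, this, concat_pos _ f hf j (by omega), add_assoc, ← lc_append,
        List.take_add_one, List.getD_eq_getElem _ _ (by omega), List.getElem?_eq_getElem (by omega)]
      rfl
  | succ l ihl =>
    intro j
    induction j with
    | zero =>
      intro _
      have := ihl _ le_rfl
      rw [List.take_length] at this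
      have e : blen f (l + 1) = blen f l + (f l).length := by simp [blen, Finset.sum_range_succ]
      rw [add_zero, e, this, Finset.sum_range_succ]
      simp [lc_nil]
    | succ j ih =>
      intro hj
      have := ih (by omega)
      rw [← Nat.add_assoc, cnt_succ, this, concat_pos _ f hf j (by omega), add_assoc, ← lc_append,
        List.take_add_one, List.getD_eq_getElem _ _ (by omega), List.getElem?_eq_getElem (by omega)]
      rfl

/-- Every position lies in a unique word. -/
lemma exists_block (f : ℕ → List ℕ) (hf : ∀ r, f r ≠ []) (i : ℕ) :
    ∃ l j, j < (f l).length ∧ i = blen f l + j := by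
  induction i with
  | zero => exact ⟨0, 0, List.length_pos_iff.mpr (hf 0), by simp [blen]⟩
  | succ i ih =>
    obtain ⟨l, j, hj, rfl⟩ := ih
    by_cases h : j + 1 < (f l).length
    · exact ⟨l, j + 1, h, by omega⟩
    · refine ⟨l + 1, 0, List.length_pos_iff.mpr (hf _), ?_⟩
      have e : blen f (l + 1) = blen f l + (f l).length := by simp [blen, Finset.sum_range_succ]
      omega

lemma app_append (a b : List ℕ) (w : Seq) : app (a ++ b) w = app a (app b w) := by
  funext i
  unfold app
  by_cases h1 : i < a.length
  · rw [if_pos (by simp; omega), if_pos h1, List.getD_append _ _ _ _ h1]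
  · by_cases h2 : i < a.length + b.length
    · rw [if_pos (by simpa using h2), if_neg h1, if_pos (by omega),
        List.getD_append_right _ _ _ _ (by omega)]
    · rw [if_neg (by simpa using h2), if_neg h1, if_neg (by omega)]
      congr 1; simp; omega

/-! ### The substitutions -/

lemma lamWord_ne (n i : ℕ) : lamWord 3 n i ≠ [] := by
  unfold lamWord; split_ifs <;> simp

lemma lamSub_eq (n : ℕ) (w : Seq) :
    lamSub 3 n w = app (lamWord 3 n (w 0)) (lamSub 3 n (shift w)) := by
  rw [lamSub_eq_concat, concat_eq _ (fun r => lamWord_ne n _)]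
  rfl

lemma lamWord_zero (n : ℕ) : lamWord 3 n 0 = [1] := by simp [lamWord]
lemma lamWord_one (n : ℕ) : lamWord 3 n 1 = 2 :: List.replicate (n + 1) 0 := by simp [lamWord]
lemma lamWord_two (n : ℕ) : lamWord 3 n 2 = 2 :: List.replicate n 0 := by simp [lamWord]

lemma lamWord_lt (n i a : ℕ) (h : a ∈ lamWord 3 n i) : a < 3 := by
  unfold lamWord at h
  split_ifs at h
  · simp at h; omega
  · simp at h; omega
  · simp at h; omega

lemma lamSub_lt (n : ℕ) (w : Seq) (i : ℕ) : lamSub 3 n w i < 3 := by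
  obtain ⟨l, j, hj, rfl⟩ := exists_block (fun r => lamWord 3 n (w r)) (fun r => lamWord_ne _ _) i
  rw [lamSub_eq_concat, concat_pos _ _ (fun r => lamWord_ne _ _) _ hj, List.getD_eq_getElem _ _ hj]
  exact lamWord_lt n _ _ (List.getElem_mem _)

lemma lamSub_head_pos (n : ℕ) (w : Seq) : 1 ≤ lamSub 3 n w 0 := by
  rw [lamSub_eq]
  unfold app lamWord
  split_ifs <;> simp_all

lemma lamSub_head (n : ℕ) (w : Seq) (h : w 0 = 2) : lamSub 3 n w 0 = 2 := by
  rw [lamSub_eq, h, lamWord_two]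
  simp [app]

/-- Agreement of the first `j` digits. -/
def agree (j : ℕ) (v w : Seq) : Prop := ∀ i, i < j → v i = w i

lemma agree_step (n : ℕ) (j : ℕ) : ∀ v w : Seq, agree j v w →
    agree j (lamSub 3 n v) (lamSub 3 n w) ∧
      (lamSub 3 n v j = lamSub 3 n w j ∨ (1 ≤ lamSub 3 n v j ∧ 1 ≤ lamSub 3 n w j)) ∧
      (1 ≤ v j → 1 ≤ w j → agree (j + 1) (lamSub 3 n v) (lamSub 3 n w)) := by
  induction j with
  | zero =>
    intro v w _
    refine ⟨fun i hi => by omega, Or.inr ⟨lamSub_head_pos n v, lamSub_head_pos n w⟩, ?_⟩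
    intro hv hw i hi
    have : i = 0 := by omega
    subst this
    have aux : ∀ u : Seq, 1 ≤ u 0 → lamSub 3 n u 0 = 2 := by
      intro u hu
      rw [lamSub_eq]
      unfold app lamWord
      split_ifs <;> simp_all <;> omega
    rw [aux v hv, aux w hw]
  | succ j ih =>
    intro v w h
    have h0 : v 0 = w 0 := h 0 (by omega)
    obtain ⟨h1, h2, h3⟩ := ih (shift v) (shift w) (fun i hi => h (i + 1) (by omega))
    have hl : 0 < (lamWord 3 n (w 0)).length := List.length_pos_iff.mpr (lamWord_ne n _)
    rw [lamSub_eq n v, lamSub_eq n w, h0]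
    refine ⟨?_, ?_, ?_⟩
    · intro i hi
      unfold app
      split_ifs with hh
      · rfl
      · exact h1 _ (by omega)
    · unfold app
      split_ifs with hh
      · exact Or.inl rfl
      · by_cases h5 : (lamWord 3 n (w 0)).length = 1
        · rw [h5]; exact h2
        · left; exact h1 _ (by omega)
    · intro hv hw i hi
      unfold app
      split_ifs with hh
      · rfl
      · exact h3 hv hw _ (by omega)

lemma agree_two (a b j : ℕ) (v w : Seq) (h : agree j v w) :
    agree (j + 1) (lamSub 3 a (lamSub 3 b v)) (lamSub 3 a (lamSub 3 b w)) := by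
  obtain ⟨h1, h2, h3⟩ := agree_step b j v w h
  rcases h2 with h2 | ⟨h2, h2'⟩
  · refine (agree_step a (j + 1) _ _ ?_).1
    intro i hi
    rcases Nat.lt_succ_iff_lt_or_eq.mp hi with h | h
    · exact h1 i h
    · rw [h]; exact h2
  · exact (agree_step a j _ _ h1).2.2 h2 h2'

lemma lamChain_succ (n : ℕ → ℕ) (r : ℕ) : ∀ w, lamChain 3 n (r + 1) w =
    lamSub 3 (n 0) (lamChain 3 (fun s => n (s + 1)) r w) := by
  induction r with
  | zero => intro w; rfl
  | succ r ih =>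
    intro w
    show lamChain 3 n (r + 1) _ = _
    rw [ih]; rfl

lemma agree_chain (r : ℕ) : ∀ (n : ℕ → ℕ) (v w : Seq),
    agree r (lamChain 3 n (2 * r) v) (lamChain 3 n (2 * r) w) := by
  induction r with
  | zero => intro n v w i hi; omega
  | succ r ih =>
    intro n v w
    have e : 2 * (r + 1) = (2 * r + 1) + 1 := by ring
    rw [e, lamChain_succ, lamChain_succ, lamChain_succ, lamChain_succ]
    exact agree_two _ _ _ _ _ (ih _ _ _)

lemma lamChain_split (n : ℕ → ℕ) (r d : ℕ) : ∀ w, ∃ v, lamChain 3 n (r + d) w = lamChain 3 n r v := by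
  induction d with
  | zero => intro w; exact ⟨w, rfl⟩
  | succ d ih => intro w; exact ih _

lemma agree_tail (n : ℕ → ℕ) (r s : ℕ) (h : 2 * r ≤ s) (v w : Seq) :
    agree r (lamChain 3 n (2 * r) v) (lamChain 3 n s w) := by
  obtain ⟨d, rfl⟩ := Nat.exists_eq_add_of_le h
  obtain ⟨u, hu⟩ := lamChain_split n (2 * r) d w
  rw [hu]
  exact agree_chain r n v u

lemma Sseq_tendsto (n : ℕ → ℕ) :
    Tendsto (fun r => lamChain 3 n r (topSeq 3)) atTop (𝓝 (Sseq 3 n)) := by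
  apply tendsto_nhds_limUnder
  refine ⟨fun i => lamChain 3 n (2 * (i + 1)) (topSeq 3) i, ?_⟩
  rw [tendsto_pi_nhds]
  intro i
  apply tendsto_const_nhds.congr'
  filter_upwards [eventually_ge_atTop (2 * (i + 1))] with s hs
  exact agree_tail n (i + 1) s hs _ _ i (by omega)

lemma Sseq_eventually (n : ℕ → ℕ) (j : ℕ) :
    ∀ᶠ r in atTop, agree j (lamChain 3 n r (topSeq 3)) (Sseq 3 n) := by
  have h := Sseq_tendsto n
  rw [tendsto_pi_nhds] at h
  have h2 : ∀ i, ∀ᶠ r in atTop, lamChain 3 n r (topSeq 3) i = Sseq 3 n i := by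
    intro i
    have := h i
    rw [nhds_discrete, tendsto_pure] at this
    exact this
  have := (eventually_all_finite (Set.finite_lt_nat j)).mpr (fun i _ => h2 i)
  filter_upwards [this] with r hr i hi
  exact hr i hi

lemma Sseq_rec (n : ℕ → ℕ) : Sseq 3 n = lamSub 3 (n 0) (Sseq 3 fun s => n (s + 1)) := by
  funext i
  obtain ⟨r, h1, h2⟩ := (((tendsto_add_atTop_nat 1).eventually (Sseq_eventually n (i + 1))).and
    (Sseq_eventually (fun s => n (s + 1)) (i + 1))).exists
  have h3 := (agree_step (n 0) _ _ _ h2).1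
  rw [← h1 i (by omega), lamChain_succ, h3 i (by omega)]

/-- Shift on `N`. -/
def shN (m : NN) : NN := ⟨fun r => m.1 (r + 1), fun r h => m.2 (r + 1) h⟩

lemma SN_top (m : NN) (h : m.1 0 = ⊤) : SN 3 m = baseSeq 3 := by
  have hex : ∃ R, m.1 R = ⊤ := ⟨0, h⟩
  unfold SN
  rw [dif_pos hex]
  have : Nat.find hex = 0 := by rw [Nat.find_eq_zero]; exact h
  rw [this]; rfl

lemma SN_rec (m : NN) (h : m.1 0 ≠ ⊤) : SN 3 m = lamSub 3 (m.1 0).toNat (SN 3 (shN m)) := by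
  by_cases hex : ∃ R, m.1 R = ⊤
  · have hex' : ∃ R, (shN m).1 R = ⊤ := by
      obtain ⟨R, hR⟩ := hex
      cases R with
      | zero => exact absurd hR h
      | succ R => exact ⟨R, hR⟩
    have e : Nat.find hex = Nat.find hex' + 1 := Nat.find_comp_succ hex hex' h
    unfold SN
    rw [dif_pos hex, dif_pos hex', e, List.range_succ_eq_map, List.map_cons, List.map_map]
    rfl
  · have hex' : ¬ ∃ R, (shN m).1 R = ⊤ := by
      rintro ⟨R, hR⟩; exact hex ⟨R + 1, hR⟩
    unfold SN
    rw [dif_neg hex, dif_neg hex', Sseq_rec]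
    rfl

lemma SN_lt (m : NN) (i : ℕ) : SN 3 m i < 3 := by
  by_cases h : m.1 0 = ⊤
  · rw [SN_top m h]; unfold baseSeq; split_ifs <;> simp
  · rw [SN_rec m h]; exact lamSub_lt _ _ _

lemma Sseq_head (n : ℕ → ℕ) : Sseq 3 n 0 = 2 := by
  obtain ⟨r, hr⟩ := (Sseq_eventually n 1).exists
  rw [← hr 0 (by omega)]
  have : ∀ (r : ℕ) (n : ℕ → ℕ), lamChain 3 n r (topSeq 3) 0 = 2 := by
    intro r
    induction r with
    | zero => intro n; exact lamSub_head _ _ rfl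
    | succ r ih => intro n; rw [lamChain_succ]; exact lamSub_head _ _ (ih _)
  exact this r n

lemma SN_head (m : NN) : SN 3 m 0 = 2 := by
  unfold SN
  split_ifs with h
  · generalize (List.range (Nat.find h)).map (fun r => (m.1 r).toNat) = l
    induction l with
    | nil => rfl
    | cons a l ih => exact lamSub_head _ _ ih
  · exact Sseq_head _

/-! ### Linear dynamics -/

/-- The inverse matrix. -/
def Mi (n : ℕ) : V →ₗ[ℝ] V where
  toFun x := ![x 1, x 0 - n * x 2, (n + 1) * x 2 - x 0]
  map_add' x y := by
    funext i; fin_cases i <;> simp <;> ring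
  map_smul' c x := by
    funext i; fin_cases i <;> simp <;> ring

/-- The abelianization of the substitution. -/
def Mm (n : ℕ) : V →ₗ[ℝ] V where
  toFun x := ![(n + 1) * x 1 + n * x 2, x 0, x 1 + x 2]
  map_add' x y := by
    funext i; fin_cases i <;> simp <;> ring
  map_smul' c x := by
    funext i; fin_cases i <;> simp <;> ring

@[simp] lemma Mi_0 (n : ℕ) (x : V) : Mi n x 0 = x 1 := rfl
@[simp] lemma Mi_1 (n : ℕ) (x : V) : Mi n x 1 = x 0 - n * x 2 := rfl
@[simp] lemma Mi_2 (n : ℕ) (x : V) : Mi n x 2 = (n + 1) * x 2 - x 0 := rfl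
@[simp] lemma Mm_0 (n : ℕ) (x : V) : Mm n x 0 = (n + 1) * x 1 + n * x 2 := rfl
@[simp] lemma Mm_1 (n : ℕ) (x : V) : Mm n x 1 = x 0 := rfl
@[simp] lemma Mm_2 (n : ℕ) (x : V) : Mm n x 2 = x 1 + x 2 := rfl

lemma V_ext {x y : V} (h0 : x 0 = y 0) (h1 : x 1 = y 1) (h2 : x 2 = y 2) : x = y := by
  funext i; fin_cases i <;> assumption

lemma Mi_Mm (n : ℕ) (x : V) : Mi n (Mm n x) = x := by
  apply V_ext <;> simp <;> ring

lemma Mm_Mi (n : ℕ) (x : V) : Mm n (Mi n x) = x := by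
  apply V_ext <;> simp <;> ring

/-- Iterated inverse matrices. -/
def orb : (ℕ → ℕ) → ℕ → V →ₗ[ℝ] V
  | _, 0 => LinearMap.id
  | n, r + 1 => (orb (fun s => n (s + 1)) r).comp (Mi (n 0))

/-- Iterated matrices. -/
def Qm : (ℕ → ℕ) → ℕ → V →ₗ[ℝ] V
  | _, 0 => LinearMap.id
  | n, r + 1 => (Mm (n 0)).comp (Qm (fun s => n (s + 1)) r)

@[simp] lemma orb_zero (n : ℕ → ℕ) (x : V) : orb n 0 x = x := rfl
@[simp] lemma Qm_zero (n : ℕ → ℕ) (x : V) : Qm n 0 x = x := rfl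
lemma orb_succ (n : ℕ → ℕ) (r : ℕ) (x : V) :
    orb n (r + 1) x = orb (fun s => n (s + 1)) r (Mi (n 0) x) := rfl
lemma Qm_succ (n : ℕ → ℕ) (r : ℕ) (x : V) :
    Qm n (r + 1) x = Mm (n 0) (Qm (fun s => n (s + 1)) r x) := rfl

lemma orb_succ' (r : ℕ) : ∀ (n : ℕ → ℕ) (x : V), orb n (r + 1) x = Mi (n r) (orb n r x) := by
  induction r with
  | zero => intro n x; rfl
  | succ r ih => intro n x; rw [orb_succ, ih, orb_succ n r]

lemma orb_Qm (r : ℕ) : ∀ (n : ℕ → ℕ) (x : V), orb n r (Qm n r x) = x := by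
  induction r with
  | zero => intro n x; rfl
  | succ r ih => intro n x; rw [orb_succ, Qm_succ, Mi_Mm, ih]

lemma Qm_orb (r : ℕ) : ∀ (n : ℕ → ℕ) (x : V), Qm n r (orb n r x) = x := by
  induction r with
  | zero => intro n x; rfl
  | succ r ih => intro n x; rw [orb_succ, Qm_succ, ih, Mm_Mi]

lemma orb_congr (r : ℕ) : ∀ (n n' : ℕ → ℕ) (_ : ∀ s, s < r → n s = n' s), orb n r = orb n' r := by
  induction r with
  | zero => intro n n' _; rfl
  | succ r ih =>
    intro n n' h
    show (orb (fun s => n (s + 1)) r).comp (Mi (n 0)) = (orb (fun s => n' (s + 1)) r).comp (Mi (n' 0))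
    rw [h 0 (by omega), ih _ _ (fun s hs => h (s + 1) (by omega))]

/-- The finite entries. -/
def nn (m : NN) : ℕ → ℕ := fun r => (m.1 r).toNat

/-- The condition at level `r`. -/
def Cond (r : ℕ) (m : NN) (x : V) : Prop := (∀ s, s < r → m.1 s ≠ ⊤) →
  0 ≤ orb (nn m) r x 0 ∧ 0 ≤ orb (nn m) r x 1 ∧ (m.1 r = ⊤ → orb (nn m) r x 2 ≤ 0)

lemma Cond_succ {r : ℕ} {m : NN} {x : V}
    (h : m.1 0 ≠ ⊤ → Cond r (shN m) (Mi (nn m 0) x)) : Cond (r + 1) m x := by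
  intro hs
  exact h (hs 0 (by omega)) (fun s hs' => hs (s + 1) (by omega))

lemma Cond_pred {r : ℕ} {m : NN} {x : V} (h0 : m.1 0 ≠ ⊤) (h : Cond (r + 1) m x) :
    Cond r (shN m) (Mi (nn m 0) x) := by
  intro hs
  refine h (fun s hs' => ?_)
  cases s with
  | zero => exact h0
  | succ s => exact hs s (by omega)

lemma Cond_add {r : ℕ} {m : NN} {x y : V} (hx : Cond r m x) (hy : Cond r m y) :
    Cond r m (x + y) := by
  intro hs
  obtain ⟨a, b, c⟩ := hx hs
  obtain ⟨a', b', c'⟩ := hy hs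
  rw [map_add]
  refine ⟨add_nonneg a a', add_nonneg b b', fun h => add_nonpos (c h) (c' h)⟩

lemma Cond_smul {r : ℕ} {m : NN} {x : V} (t : ℝ) (ht : 0 ≤ t) (hx : Cond r m x) :
    Cond r m (t • x) := by
  intro hs
  obtain ⟨a, b, c⟩ := hx hs
  rw [map_smul]
  refine ⟨mul_nonneg ht a, mul_nonneg ht b, fun h => mul_nonpos_of_nonneg_of_nonpos ht (c h)⟩

def Cminus (x : V) : Prop := 0 ≤ x 0 ∧ 0 ≤ x 1 ∧ x 2 ≤ 0

lemma Cminus_Mi {x : V} (n : ℕ) (h : Cminus x) : Cminus (Mi n x) := by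
  obtain ⟨a, b, c⟩ := h
  have hn : (0 : ℝ) ≤ n := Nat.cast_nonneg n
  have := mul_nonpos_of_nonneg_of_nonpos hn c
  refine ⟨b, ?_, ?_⟩
  · simp; linarith
  · simp; linarith

lemma Cminus_orb (r : ℕ) : ∀ (n : ℕ → ℕ) (x : V), Cminus x → Cminus (orb n r x) := by
  induction r with
  | zero => intro n x h; exact h
  | succ r ih => intro n x h; exact ih _ _ (Cminus_Mi _ h)

lemma Cond_of_Cminus {x : V} (r : ℕ) (m : NN) (h : Cminus x) : Cond r m x := by
  intro _
  obtain ⟨a, b, c⟩ := Cminus_orb r (nn m) x h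
  exact ⟨a, b, fun _ => c⟩

/-- The closed convex cone attached to `m`. -/
def Dc (m : NN) : Set V := {x | ∀ r, Cond r m x}

lemma sum_lamWord (n : ℕ) (w : Seq) (hw : ∀ i, w i < 3) (l : ℕ) :
    ∑ t ∈ Finset.range l, lc (lamWord 3 n (w t)) = Mm n (cnt w l) := by
  induction l with
  | zero => simp [cnt_zero]
  | succ l ih =>
    rw [Finset.sum_range_succ, ih, cnt_succ, map_add]
    congr 1
    have h := hw l
    interval_cases w l
    · rw [lamWord_zero]; apply V_ext <;> simp [lc]
    · rw [lamWord_one]; apply V_ext <;> simp [lc, List.count_cons, List.count_replicate]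
    · rw [lamWord_two]; apply V_ext <;> simp [lc, List.count_cons, List.count_replicate]

lemma blk_lemma (n : ℕ) (w : Seq) (hw : ∀ i, w i < 3) (i : ℕ) :
    ∃ l, (cnt (lamSub 3 n w) i = Mm n (cnt w l) ∧ (w l = 0 → lamSub 3 n w i = 1) ∧
        (1 ≤ i → 1 ≤ l)) ∨
      (1 ≤ w l ∧ lamSub 3 n w i = 0 ∧ ∃ q : ℕ, q ≤ n ∧
        cnt (lamSub 3 n w) i = Mm n (cnt w l) + ![(q : ℝ), 0, 1]) := by
  obtain ⟨l, j, hj, rfl⟩ := exists_block (fun r => lamWord 3 n (w r)) (fun r => lamWord_ne _ _) i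
  refine ⟨l, ?_⟩
  rw [lamSub_eq_concat, concat_pos _ _ (fun r => lamWord_ne _ _) _ hj,
    cnt_concat _ (fun r => lamWord_ne _ _) _ _ hj.le, sum_lamWord n w hw]
  cases j with
  | zero =>
    left
    refine ⟨by simp [lc_nil], fun h => by simp [h, lamWord_zero], ?_⟩
    intro h
    by_contra hl
    have : l = 0 := by omega
    subst this
    simp [blen] at h
  | succ j =>
    right
    have aux : ∀ K, j < K → K ≤ n + 1 →
        lc (List.take (j + 1) (2 :: List.replicate K 0)) = ![(j : ℝ), 0, 1] := by
      intro K h1 h2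
      have : min j K = j := by omega
      apply V_ext <;> simp [lc, List.count_cons, List.count_replicate, this]
    have h := hw l
    have h3 : w l = 0 ∨ w l = 1 ∨ w l = 2 := by omega
    rcases h3 with h3 | h3 | h3
    · simp [h3, lamWord_zero] at hj
    · simp only [h3, lamWord_one, List.length_cons, List.length_replicate] at hj ⊢
      refine ⟨le_rfl, by simp, j, by omega, ?_⟩
      rw [aux (n + 1) (by omega) (by omega)]
    · simp only [h3, lamWord_two, List.length_cons, List.length_replicate] at hj ⊢
      refine ⟨by omega, by simp, j, by omega, ?_⟩
      rw [aux n (by omega) (by omega)]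

lemma cnt_nonneg (v : Seq) (i : ℕ) (d : Fin 3) : 0 ≤ cnt v i d := Nat.cast_nonneg _

lemma cnt_base (i : ℕ) : cnt (baseSeq 3) (i + 1) 2 = 1 := by
  induction i with
  | zero => rw [cnt_succ, cnt_zero]; simp [lc, baseSeq]
  | succ i ih => rw [cnt_succ, Pi.add_apply, ih]; simp [lc, baseSeq]

lemma init_claims (r : ℕ) : ∀ (m : NN) (i : ℕ),
    (1 ≤ SN 3 m i → Cond r m (cnt (SN 3 m) i + ![1, 0, 0])) ∧
    (SN 3 m i = 2 → Cond r m (cnt (SN 3 m) i + ![0, 1, 0])) ∧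
    (1 ≤ i → Cond r m (cnt (SN 3 m) i + ![0, 1, -1])) ∧
    (1 ≤ i → Cond r m (cnt (SN 3 m) i + ![1, 0, -1])) := by
  induction r with
  | zero =>
    intro m i
    have h0 := cnt_nonneg (SN 3 m) i 0
    have h1 := cnt_nonneg (SN 3 m) i 1
    have key : m.1 0 = ⊤ → (1 ≤ SN 3 m i → cnt (SN 3 m) i 2 = 0) ∧
        (1 ≤ i → cnt (SN 3 m) i 2 = 1) := by
      intro h
      rw [SN_top m h]
      constructor
      · intro h
        have : i = 0 := by
          by_contra hi; simp [baseSeq, hi] at h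
        rw [this, cnt_zero]; rfl
      · intro h
        obtain ⟨i, rfl⟩ := Nat.exists_eq_add_of_le' h
        exact cnt_base i
    refine ⟨fun h _ => ⟨?_, ?_, fun ht => ?_⟩, fun h _ => ⟨?_, ?_, fun ht => ?_⟩,
      fun h _ => ⟨?_, ?_, fun ht => ?_⟩, fun h _ => ⟨?_, ?_, fun ht => ?_⟩⟩
    all_goals simp only [orb_zero, Pi.add_apply]
    all_goals try simp
    all_goals try linarith
    · exact ((key ht).1 h).le
    · exact ((key ht).1 (by omega)).le
    · exact ((key ht).2 h).le
    · exact ((key ht).2 h).le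
  | succ r ih =>
    intro m i
    by_cases hm : m.1 0 = ⊤
    · have : ∀ x, Cond (r + 1) m x := fun x => Cond_succ (fun h => absurd hm h)
      exact ⟨fun _ => this _, fun _ => this _, fun _ => this _, fun _ => this _⟩
    have hrec := SN_rec m hm
    set S' := SN 3 (shN m) with hS'
    have hn : (m.1 0).toNat = nn m 0 := rfl
    rw [hn] at hrec
    set n := nn m 0 with hnn
    obtain ⟨l, hl⟩ := blk_lemma n S' (SN_lt _) i
    obtain ⟨hA, -, hB, hD⟩ := ih (shN m) l
    have cm : ∀ x : V, Cminus x → Cond r (shN m) x := fun x => Cond_of_Cminus r _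
    have n0 : (0 : ℝ) ≤ n := Nat.cast_nonneg n
    rw [hrec]
    have red : ∀ x v z : V, x = Mi n v + z → Cond r (shN m) z → Cond r (shN m) (Mi n v) →
        Cond r (shN m) x := fun x v z h h1 h2 => by rw [h]; exact Cond_add h2 h1
    rcases hl with ⟨hc, h0, hi⟩ | ⟨hw, h0, q, hq, hc⟩
    · rw [hc]
      have i0 : l = 0 → Cond r (shN m) (cnt S' l) := by
        intro h; rw [h, cnt_zero]; exact cm _ ⟨le_rfl, le_rfl, le_rfl⟩
      refine ⟨fun _ => ?_, fun h2 => ?_, fun h1 => ?_, fun h1 => ?_⟩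
      all_goals refine Cond_succ fun _ => ?_
      all_goals rw [map_add, Mi_Mm]
      · -- A
        have e : Mi n ![1, 0, 0] = ![0, 1, -1] := by apply V_ext <;> simp
        rw [e]
        by_cases hl0 : l = 0
        · exact Cond_add (i0 hl0) (cm _ (by simp [Cminus]))
        · exact hB (by omega)
      · have e : Mi n ![0, 1, 0] = ![1, 0, 0] := by apply V_ext <;> simp
        rw [e]
        refine hA ?_
        by_contra h3
        have := h0 (Nat.lt_one_iff.mp (not_le.mp h3))
        omega
      · have hl1 := hi h1
        rcases Nat.eq_zero_or_pos n with hz | hz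
        · have e : Mi n ![0, 1, -1] = ![1, 0, -1] := by apply V_ext <;> simp [hz]
          rw [e]; exact hD hl1
        · have e : Mi n ![0, 1, -1] = ![0, 1, -1] + ![1, (n : ℝ) - 1, -n] := by
            apply V_ext <;> simp
          rw [e, ← add_assoc]
          have : (1 : ℝ) ≤ n := by exact_mod_cast hz
          exact Cond_add (hB hl1) (cm _ (by simp [Cminus]; linarith))
      · have hl1 := hi h1
        have e : Mi n ![1, 0, -1] = ![0, 1, -1] + ![0, (n : ℝ), -n - 1] := by
          apply V_ext <;> simp <;> ring
        rw [e, ← add_assoc]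
        exact Cond_add (hB hl1) (cm _ (by simp [Cminus]; linarith))
    · rw [hc]
      have q0 : (0 : ℝ) ≤ q := Nat.cast_nonneg q
      have C0 : ∀ q' : ℕ, Cond r (shN m) (cnt S' l + ![0, (q' : ℝ) + 1, -q' - 1]) := by
        intro q'
        have q0 : (0 : ℝ) ≤ q' := Nat.cast_nonneg q'
        by_cases hl0 : l = 0
        · rw [hl0, cnt_zero, zero_add]
          exact cm _ (by simp [Cminus]; constructor <;> linarith)
        · have e : (![0, (q' : ℝ) + 1, -q' - 1] : V) = ![0, 1, -1] + ![0, (q' : ℝ), -q'] := by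
            apply V_ext <;> simp <;> ring
          rw [e, ← add_assoc]
          exact Cond_add (hB (by omega)) (cm _ (by simp [Cminus]))
      refine ⟨fun h => by omega, fun h => by omega, fun h1 => ?_, fun h1 => ?_⟩
      all_goals refine Cond_succ fun _ => ?_
      all_goals rw [add_assoc, map_add, Mi_Mm]
      · cases q with
        | zero =>
          have e : Mi n (![((0 : ℕ) : ℝ), 0, 1] + ![0, 1, -1]) = ![1, 0, 0] := by
            apply V_ext <;> simp
          rw [e]; exact hA hw
        | succ q =>
          have e : Mi n (![((q + 1 : ℕ) : ℝ), 0, 1] + ![0, 1, -1]) =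
              ![0, (q : ℝ) + 1, -q - 1] + ![1, 0, 0] := by
            apply V_ext <;> simp; ring
          rw [e, ← add_assoc]
          exact Cond_add (C0 q) (cm _ (by simp [Cminus]))
      · have e : Mi n (![(q : ℝ), 0, 1] + ![1, 0, -1]) = ![0, (q : ℝ) + 1, -q - 1] := by
          apply V_ext <;> simp; ring
        rw [e]; exact C0 q

lemma shift_iter (v : Seq) (r i : ℕ) : shift^[r] v i = v (r + i) := by
  induction r generalizing v with
  | zero => simp
  | succ r ih => rw [Function.iterate_succ_apply, ih]; unfold shift; congr 1; omega

lemma cnt_add (v : Seq) (a b : ℕ) : cnt v (a + b) = cnt v a + cnt (shift^[a] v) b := by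
  induction b with
  | zero => simp [cnt_zero]
  | succ b ih => rw [← Nat.add_assoc, cnt_succ, ih, cnt_succ, shift_iter, add_assoc]

lemma Xset_shift {w v : Seq} (h : v ∈ Xset 3 w) (a : ℕ) : shift^[a] v ∈ Xset 3 w := by
  refine ⟨fun r => ?_, fun r => ?_⟩
  · rw [shift_iter]; exact h.1 _
  · rw [← Function.iterate_add_apply]; exact h.2 _

lemma cnt_congr {v w : Seq} {l : ℕ} (h : ∀ i, i < l → v i = w i) : cnt v l = cnt w l := by
  induction l with
  | zero => simp [cnt_zero]
  | succ l ih =>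
    rw [cnt_succ, cnt_succ, ih (fun i hi => h i (by omega)), h l (by omega)]

lemma Xset_claim (m : NN) (r : ℕ) (l : ℕ) : ∀ v ∈ Xset 3 (SN 3 m),
    Cond r m (cnt v l + ![0, 1, -1]) := by
  induction l using Nat.strong_induction_on with
  | _ l ih =>
    intro v hv
    by_cases heq : ∀ i, i < l → v i = SN 3 m i
    · rw [cnt_congr heq]
      by_cases hl : l = 0
      · rw [hl, cnt_zero]; exact Cond_of_Cminus r m (by simp [Cminus])
      · exact (init_claims r m l).2.2.1 (by omega)
    · push Not at heq
      obtain ⟨i, hi, hne⟩ := heq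
      rcases hv.2 0 with ⟨j, hj, hlt⟩ | he
      · simp only [Function.iterate_zero, id] at hj hlt
        have hjl : j < l := by
          by_contra hc
          exact hne (hj i (by omega))
        have h1 : Cond r m (cnt v (j + 1)) := by
          rw [cnt_succ, cnt_congr hj]
          have h3 := SN_lt m j
          have : v j = 0 ∨ (v j = 1 ∧ SN 3 m j = 2) := by omega
          rcases this with h | ⟨h, h'⟩
          · have e : lc [v j] = ![1, 0, 0] := by rw [h]; apply V_ext <;> simp [lc]
            rw [e]; exact (init_claims r m j).1 (by omega)
          · have e : lc [v j] = ![0, 1, 0] := by rw [h]; apply V_ext <;> simp [lc]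
            rw [e]; exact (init_claims r m j).2.1 h'
        obtain ⟨d, rfl⟩ := Nat.exists_eq_add_of_le (show j + 1 ≤ l by omega)
        rw [cnt_add, add_assoc]
        exact Cond_add h1 (ih d (by omega) _ (Xset_shift hv _))
      · exact absurd (congrFun he i) hne

lemma Cond_closed (r : ℕ) (m : NN) : IsClosed {x | Cond r m x} := by
  have hc : Continuous (orb (nn m) r) := LinearMap.continuous_of_finiteDimensional _
  have hi : ∀ i, Continuous fun x => orb (nn m) r x i := fun i => (continuous_apply i).comp hc
  by_cases h : ∀ s, s < r → m.1 s ≠ ⊤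
  · have e : {x | Cond r m x} = {x | 0 ≤ orb (nn m) r x 0} ∩ ({x | 0 ≤ orb (nn m) r x 1} ∩
        {x | m.1 r = ⊤ → orb (nn m) r x 2 ≤ 0}) := by
      ext x
      exact ⟨fun hx => hx h, fun hx _ => hx⟩
    rw [e]
    refine (isClosed_le continuous_const (hi 0)).inter
      ((isClosed_le continuous_const (hi 1)).inter ?_)
    by_cases h2 : m.1 r = ⊤
    · simp only [h2, true_imp_iff]; exact isClosed_le (hi 2) continuous_const
    · simp [h2]
  · have e : {x | Cond r m x} = Set.univ := by
      ext x
      exact ⟨fun _ => trivial, fun _ h' => absurd h' h⟩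
    rw [e]; exact isClosed_univ

lemma Dc_closed (m : NN) : IsClosed (Dc m) := by
  have : Dc m = ⋂ r, {x | Cond r m x} := by ext x; simp [Dc]
  rw [this]; exact isClosed_iInter fun r => Cond_closed r m

/-- Upper bound for the digit frequency set. -/
lemma DF_subset (m : NN) (α : E 3) (h : α ∈ DFN 3 m) : (fun i => α i) ∈ Dc m := by
  obtain ⟨_, v, hv, hf⟩ := h
  have hlim : Tendsto (fun r : ℕ => ((r : ℝ)⁻¹) • (cnt v r + ![0, 1, -1])) atTop
      (𝓝 (fun i => α i)) := by
    rw [tendsto_pi_nhds]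
    intro i
    have h1 := hf i i.2
    have h2 : proj α (i : ℕ) = α i := by simp [proj]
    rw [h2] at h1
    have h3 : Tendsto (fun r : ℕ => ((r : ℝ)⁻¹) * (![0, 1, -1] : V) i) atTop (𝓝 0) := by
      simpa using (tendsto_inv_atTop_nhds_zero_nat (𝕜 := ℝ)).mul_const ((![0, 1, -1] : V) i)
    have h4 := h1.add h3
    rw [add_zero] at h4
    refine h4.congr fun r => ?_
    simp only [Pi.smul_apply, Pi.add_apply, smul_eq_mul, cnt]
    ring
  refine (Dc_closed m).mem_of_tendsto hlim (Eventually.of_forall fun r => ?_)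
  intro k
  exact Cond_smul _ (by positivity) (Xset_claim m k r v hv)

/-! ### Admissible words -/

/-- A word is strictly smaller than (the corresponding prefix of) a sequence. -/
def sLt : List ℕ → Seq → Prop
  | [], _ => False
  | a :: s, w => a < w 0 ∨ (a = w 0 ∧ sLt s (shift w))

/-- Words all of whose nonempty suffixes are strictly smaller than `w`. -/
def WW (w : Seq) : List ℕ → Prop
  | [] => True
  | a :: u => a < 3 ∧ sLt (a :: u) w ∧ WW w u

lemma sLt_append (u v : List ℕ) : ∀ w, sLt u w → sLt (u ++ v) w := by
  induction u with
  | nil => intro w h; exact h.elim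
  | cons a u ih =>
    intro w h
    rcases h with h | ⟨h, h'⟩
    · exact Or.inl h
    · exact Or.inr ⟨h, ih _ h'⟩

lemma WW_append (w : Seq) (u v : List ℕ) (hu : WW w u) (hv : WW w v) : WW w (u ++ v) := by
  induction u with
  | nil => exact hv
  | cons a u ih =>
    obtain ⟨h1, h2, h3⟩ := hu
    exact ⟨h1, sLt_append _ v _ h2, ih h3⟩

lemma app_nil (w : Seq) : app [] w = w := by funext i; simp [app]

lemma app_cons_zero (a : ℕ) (u : List ℕ) (w : Seq) : app (a :: u) w 0 = a := by simp [app]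

lemma app_cons_succ (a : ℕ) (u : List ℕ) (w : Seq) (i : ℕ) :
    app (a :: u) w (i + 1) = app u w i := by simp [app]

lemma shift_app_cons (a : ℕ) (u : List ℕ) (w : Seq) : shift (app (a :: u) w) = app u w := by
  funext i; exact app_cons_succ a u w i

lemma sLt_seqLt (u : List ℕ) : ∀ (w v : Seq), sLt u w → seqLt (app u v) w := by
  induction u with
  | nil => intro w v h; exact h.elim
  | cons a u ih =>
    intro w v h
    rcases h with h | ⟨h, h'⟩
    · exact ⟨0, fun s hs => absurd hs (by omega), by rw [app_cons_zero]; exact h⟩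
    · obtain ⟨r, h1, h2⟩ := ih _ v h'
      refine ⟨r + 1, fun s hs => ?_, ?_⟩
      · cases s with
        | zero => rw [app_cons_zero, h]
        | succ s => rw [app_cons_succ]; exact h1 s (by omega)
      · rw [app_cons_succ]; exact h2

lemma sLt_cancel (p : List ℕ) (s : List ℕ) (w : Seq) (h : sLt s w) : sLt (p ++ s) (app p w) := by
  induction p with
  | nil => rw [app_nil]; exact h
  | cons a p ih =>
    right
    rw [shift_app_cons, app_cons_zero]
    exact ⟨rfl, ih⟩

lemma concat_mem_Xset (w : Seq) (f : ℕ → List ℕ) (hf : ∀ r, f r ≠ []) (hw : ∀ r, WW w (f r)) :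
    concat f ∈ Xset 3 w := by
  have key : ∀ r, ∃ (a : ℕ) (u : List ℕ) (g : ℕ → List ℕ), (∀ r, g r ≠ []) ∧ (∀ r, WW w (g r)) ∧
      WW w (a :: u) ∧ shift^[r] (concat f) = app (a :: u) (concat g) := by
    have base : ∀ g : ℕ → List ℕ, (∀ r, g r ≠ []) → (∀ r, WW w (g r)) →
        ∃ (a : ℕ) (u : List ℕ) (g' : ℕ → List ℕ), (∀ r, g' r ≠ []) ∧ (∀ r, WW w (g' r)) ∧
      WW w (a :: u) ∧ concat g = app (a :: u) (concat g') := by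
      intro g h1 h2
      rcases h : g 0 with _ | ⟨a, u⟩
      · exact absurd h (h1 0)
      · refine ⟨a, u, fun r => g (r + 1), fun r => h1 _, fun r => h2 _, h ▸ h2 0, ?_⟩
        rw [concat_eq g h1, h]
    intro r
    induction r with
    | zero => exact base f hf hw
    | succ r ih =>
      obtain ⟨a, u, g, h1, h2, h3, h4⟩ := ih
      rw [Function.iterate_succ_apply', h4, shift_app_cons]
      cases u with
      | nil => rw [app_nil]; exact base g h1 h2
      | cons b u => exact ⟨b, u, g, h1, h2, h3.2.2, rfl⟩
  constructor
  · intro r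
    obtain ⟨a, u, g, h1, h2, h3, h4⟩ := key r
    have : shift^[r] (concat f) 0 = concat f r := by rw [shift_iter]; simp
    rw [← this, h4, app_cons_zero]
    exact h3.1
  · intro r
    obtain ⟨a, u, g, h1, h2, h3, h4⟩ := key r
    rw [h4]
    exact Or.inl (sLt_seqLt _ _ _ h3.2.1)

lemma WW_lt (w : Seq) (u : List ℕ) (h : WW w u) : ∀ a ∈ u, a < 3 := by
  induction u with
  | nil => simp
  | cons b u ih =>
    intro a ha
    rcases List.mem_cons.mp ha with rfl | ha
    · exact h.1
    · exact ih h.2.2 a ha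

lemma sLt_lam (n : ℕ) (u : List ℕ) : ∀ (w : Seq) (_ : ∀ i, w i < 3) (_ : ∀ a ∈ u, a < 3),
    sLt u w → sLt (u.flatMap (lamWord 3 n)) (lamSub 3 n w) := by
  induction u with
  | nil => intro w _ _ h; exact h.elim
  | cons a u ih =>
    intro w hw hu h
    rw [List.flatMap_cons, lamSub_eq]
    rcases h with h | ⟨h, h'⟩
    · have h3 := hw 0
      have : a = 0 ∨ a = 1 := by omega
      rcases this with rfl | rfl
      · have : w 0 = 1 ∨ w 0 = 2 := by omega
        left
        rcases this with h0 | h0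
        · rw [h0, lamWord_one, app_cons_zero]; omega
        · rw [h0, lamWord_two, app_cons_zero]; omega
      · have h0 : w 0 = 2 := by omega
        have e : (2 :: List.replicate (n + 1) 0) ++ List.flatMap (lamWord 3 n) u =
          (2 :: List.replicate n 0) ++ (0 :: List.flatMap (lamWord 3 n) u) := by
          rw [List.replicate_succ']; simp
        rw [h0, lamWord_one, lamWord_two, e]
        apply sLt_cancel
        left
        exact lamSub_head_pos _ _
    · rw [h]
      apply sLt_cancel
      exact ih _ (fun i => hw (i + 1)) (fun b hb => hu b (List.mem_cons_of_mem _ hb)) h'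

lemma WW_lam (n : ℕ) (w : Seq) (hw : ∀ i, w i < 3) (u : List ℕ) (h : WW w u) :
    WW (lamSub 3 n w) (u.flatMap (lamWord 3 n)) := by
  induction u with
  | nil => trivial
  | cons a u ih =>
    have hs := sLt_lam n (a :: u) w hw (WW_lt _ _ h) h.2.1
    have ih' := ih h.2.2
    rw [List.flatMap_cons] at hs ⊢
    have hz : ∀ K, WW (lamSub 3 n w) (List.replicate K 0) := by
      intro K
      induction K with
      | zero => trivial
      | succ K ihK => exact ⟨by omega, Or.inl (lamSub_head_pos _ _), ihK⟩
    have ha := h.1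
    have : a = 0 ∨ a = 1 ∨ a = 2 := by omega
    rcases this with rfl | rfl | rfl
    · rw [lamWord_zero] at hs ⊢
      exact ⟨by omega, hs, ih'⟩
    · rw [lamWord_one] at hs ⊢
      exact ⟨by omega, hs, WW_append _ _ _ (hz _) ih'⟩
    · rw [lamWord_two] at hs ⊢
      exact ⟨by omega, hs, WW_append _ _ _ (hz _) ih'⟩

lemma lc_lamWord (n a : ℕ) (ha : a < 3) : lc (lamWord 3 n a) = Mm n (lc [a]) := by
  have : a = 0 ∨ a = 1 ∨ a = 2 := by omega
  rcases this with rfl | rfl | rfl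
  · rw [lamWord_zero]; apply V_ext <;> simp [lc]
  · rw [lamWord_one]; apply V_ext <;> simp [lc, List.count_replicate]
  · rw [lamWord_two]; apply V_ext <;> simp [lc, List.count_replicate]

lemma lc_lam (n : ℕ) (u : List ℕ) (h : ∀ a ∈ u, a < 3) :
    lc (u.flatMap (lamWord 3 n)) = Mm n (lc u) := by
  induction u with
  | nil => simp [lc_nil]
  | cons a u ih =>
    have e : a :: u = [a] ++ u := rfl
    rw [List.flatMap_cons, lc_append, e, lc_append, map_add, lc_lamWord n a (h a (by simp)),
      ih (fun b hb => h b (List.mem_cons_of_mem _ hb))]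

lemma WW_pow (w : Seq) (u : List ℕ) (h : WW w u) (k : ℕ) : WW w (List.replicate k u).flatten := by
  induction k with
  | zero => trivial
  | succ k ih => rw [List.replicate_succ, List.flatten_cons]; exact WW_append _ _ _ h ih

lemma lc_pow (u : List ℕ) (k : ℕ) : lc (List.replicate k u).flatten = (k : ℝ) • lc u := by
  induction k with
  | zero => simp [lc_nil]
  | succ k ih =>
    rw [List.replicate_succ, List.flatten_cons, lc_append, ih]; push_cast; rw [add_smul, one_smul,
      add_comm]

/-- Rational cone of admissible word counts. -/
def K0 (w : Seq) : AddSubmonoid V where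
  carrier := {x | ∃ k : ℕ, 0 < k ∧ ∃ u, WW w u ∧ (k : ℝ) • x = lc u}
  zero_mem' := ⟨1, one_pos, [], trivial, by simp [lc_nil]⟩
  add_mem' := by
    rintro x y ⟨k, hk, u, hu, h⟩ ⟨l, hl, v, hv, h'⟩
    refine ⟨k * l, Nat.mul_pos hk hl, (List.replicate l u).flatten ++ (List.replicate k v).flatten,
      WW_append _ _ _ (WW_pow _ _ hu _) (WW_pow _ _ hv _), ?_⟩
    rw [lc_append, lc_pow, lc_pow, ← h, ← h', smul_smul, smul_smul, smul_add, Nat.cast_mul,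
      mul_comm (l : ℝ)]

/-- Its closure. -/
def KK (w : Seq) : AddSubmonoid V := (K0 w).topologicalClosure

lemma KK_closed (w : Seq) : IsClosed (KK w : Set V) := (K0 w).isClosed_topologicalClosure

lemma KK_of_word (w : Seq) (u : List ℕ) (h : WW w u) : lc u ∈ KK w :=
  (K0 w).le_topologicalClosure ⟨1, one_pos, u, h, by simp⟩

lemma KK_smul (w : Seq) (t : ℝ) (ht : 0 ≤ t) (x : V) (hx : x ∈ KK w) : t • x ∈ KK w := by
  have h1 : ∀ x ∈ K0 w, t • x ∈ KK w := by
    rintro x ⟨k, hk, u, hu, h⟩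
    have hl : Tendsto (fun j : ℕ => ((⌊t * (j : ℝ)⌋₊ : ℝ) / (j : ℝ)) • x) atTop (𝓝 (t • x)) :=
      ((tendsto_nat_floor_mul_div_atTop ht).comp tendsto_natCast_atTop_atTop).smul_const x
    refine (KK_closed w).mem_of_tendsto hl ?_
    filter_upwards [eventually_gt_atTop 0] with j hj
    refine (K0 w).le_topologicalClosure ⟨k * j, Nat.mul_pos hk hj,
      (List.replicate ⌊t * (j : ℝ)⌋₊ u).flatten, WW_pow _ _ hu _, ?_⟩
    have hj' : (j : ℝ) ≠ 0 := by exact_mod_cast hj.ne'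
    rw [lc_pow, ← h, smul_smul, smul_smul]
    congr 1
    push_cast
    field_simp
  have hc : IsClosed {x : V | t • x ∈ KK w} := (KK_closed w).preimage (continuous_const_smul t)
  exact closure_minimal (s := (K0 w : Set V)) h1 hc hx

lemma KK_Mm (n : ℕ) (w : Seq) (hw : ∀ i, w i < 3) (x : V) (hx : x ∈ KK w) :
    Mm n x ∈ KK (lamSub 3 n w) := by
  have h1 : ∀ x ∈ K0 w, Mm n x ∈ KK (lamSub 3 n w) := by
    rintro x ⟨k, hk, u, hu, h⟩
    refine (K0 _).le_topologicalClosure ⟨k, hk, u.flatMap (lamWord 3 n), WW_lam n w hw u hu, ?_⟩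
    rw [lc_lam n u (WW_lt _ _ hu), ← h, map_smul]
  have hc : IsClosed {x : V | Mm n x ∈ KK (lamSub 3 n w)} :=
    (KK_closed _).preimage (LinearMap.continuous_of_finiteDimensional _)
  exact closure_minimal (s := (K0 w : Set V)) h1 hc hx

lemma KK_e0 (m : NN) : (![1, 0, 0] : V) ∈ KK (SN 3 m) := by
  have : lc [0] = ![1, 0, 0] := by apply V_ext <;> simp [lc]
  rw [← this]
  exact KK_of_word _ _ ⟨by omega, Or.inl (by rw [SN_head]; omega), trivial⟩

lemma KK_e1 (m : NN) : (![0, 1, 0] : V) ∈ KK (SN 3 m) := by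
  have : lc [1] = ![0, 1, 0] := by apply V_ext <;> simp [lc]
  rw [← this]
  exact KK_of_word _ _ ⟨by omega, Or.inl (by rw [SN_head]; omega), trivial⟩

lemma KK_step (m : NN) (h : m.1 0 ≠ ⊤) (x : V) (hx : x ∈ KK (SN 3 (shN m))) :
    Mm (nn m 0) x ∈ KK (SN 3 m) := by
  rw [SN_rec m h]; exact KK_Mm _ _ (SN_lt _) _ hx

lemma KK_orb (r : ℕ) : ∀ (m : NN) (_ : ∀ s, s < r → m.1 s ≠ ⊤) (x : V)
    (_ : x ∈ KK (SN 3 (shN^[r] m))), Qm (nn m) r x ∈ KK (SN 3 m) := by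
  induction r with
  | zero => intro m _ x hx; exact hx
  | succ r ih =>
    intro m hm x hx
    rw [Qm_succ]
    apply KK_step m (hm 0 (by omega))
    exact ih (shN m) (fun s hs => hm (s + 1) (by omega)) x hx

lemma Dc_shift (m : NN) (h : m.1 0 ≠ ⊤) (x : V) (hx : x ∈ Dc m) : Mi (nn m 0) x ∈ Dc (shN m) :=
  fun r => Cond_pred h (hx (r + 1))

lemma Dc_zero (m : NN) (x : V) (hx : x ∈ Dc m) : 0 ≤ x 0 ∧ 0 ≤ x 1 ∧ (m.1 0 = ⊤ → x 2 ≤ 0) :=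
  hx 0 (fun s hs => absurd hs (by omega))

lemma KK_neg (r : ℕ) : ∀ (m : NN) (x : V), x ∈ Dc m → 0 ≤ x 2 → (∀ s, s < r → m.1 s ≠ ⊤) →
    orb (nn m) r x 2 ≤ 0 → x ∈ KK (SN 3 m) := by
  induction r with
  | zero =>
    intro m x hx h2 _ h
    obtain ⟨h0, h1, -⟩ := Dc_zero m x hx
    have e : x = x 0 • ![1, 0, 0] + x 1 • ![0, 1, 0] := by
      have : x 2 = 0 := le_antisymm h h2
      apply V_ext <;> simp [this]
    rw [e]
    exact add_mem (KK_smul _ _ h0 _ (KK_e0 m)) (KK_smul _ _ h1 _ (KK_e1 m))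
  | succ r ih =>
    intro m x hx h2 hs h
    have h0 := hs 0 (by omega)
    rcases le_total 0 (Mi (nn m 0) x 2) with hc | hc
    · have := ih (shN m) (Mi (nn m 0) x) (Dc_shift m h0 x hx) hc (fun s hs' => hs (s + 1) (by omega)) h
      have := KK_step m h0 _ this
      rwa [Mm_Mi] at this
    · obtain ⟨h0', h1', -⟩ := Dc_zero m x hx
      have e : x = (x 0 - (nn m 0 + 1) * x 2) • ![1, 0, 0] + x 1 • ![0, 1, 0] +
          x 2 • Mm (nn m 0) ![0, 1, 0] := by
        apply V_ext <;> simp <;> ring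
      rw [Mi_2] at hc
      have hh : 0 ≤ x 0 - (nn m 0 + 1) * x 2 := by linarith
      rw [e]
      exact add_mem (add_mem (KK_smul _ _ hh _ (KK_e0 m))
        (KK_smul _ _ h1' _ (KK_e1 m))) (KK_smul _ _ h2 _ (KK_step m h0 _ (KK_e1 _)))

/-! ### Fiber points -/

lemma orb_add (k r : ℕ) : ∀ (n : ℕ → ℕ) (x : V),
    orb n (k + r) x = orb (fun s => n (k + s)) r (orb n k x) := by
  induction r with
  | zero => intro n x; rfl
  | succ r ih =>
    intro n x
    rw [← add_assoc, orb_succ', ih, orb_succ' r]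

lemma shN_iter (r : ℕ) : ∀ (m : NN) (s : ℕ), (shN^[r] m).1 s = m.1 (r + s) := by
  induction r with
  | zero => intro m s; simp
  | succ r ih =>
    intro m s
    rw [Function.iterate_succ_apply, ih]
    show m.1 (r + s + 1) = m.1 (r + 1 + s)
    rw [show r + s + 1 = r + 1 + s by omega]

/-- Nonnegative forward orbits. -/
def AF (n : ℕ → ℕ) : Set V := {x | ∀ r i, 0 ≤ orb n r x i}

lemma orb2_succ (n : ℕ → ℕ) (r : ℕ) (x : V) :
    orb n (r + 1) x 2 = orb n r x 2 - orb n (r + 1) x 1 := by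
  rw [orb_succ']; simp; ring

lemma orb2_anti (n : ℕ → ℕ) (x : V) (h : ∀ r, 0 ≤ orb n r x 1) :
    Antitone fun r => orb n r x 2 := by
  apply antitone_nat_of_succ_le
  intro r
  have := orb2_succ n r x
  have := h (r + 1)
  linarith

lemma orb_sum_bound (n : ℕ → ℕ) (x : V) (h : x ∈ AF n) (r : ℕ) :
    ((∑ j ∈ Finset.range r, n j : ℕ) : ℝ) * orb n r x 2 +
      (orb n r x 0 + orb n r x 1 + orb n r x 2) ≤ x 0 + x 1 + x 2 := by
  induction r with
  | zero => simp
  | succ r ih =>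
    rw [Finset.sum_range_succ]
    push_cast
    push_cast at ih
    have h1 := h r
    have h2 := h (r + 1)
    have ha : orb n (r + 1) x 2 ≤ orb n r x 2 :=
      orb2_anti n x (fun r => h r 1) (Nat.le_succ r)
    have e0 : orb n (r + 1) x 0 = orb n r x 1 := by rw [orb_succ']; simp
    have e1 : orb n (r + 1) x 1 = orb n r x 0 - n r * orb n r x 2 := by rw [orb_succ']; simp
    have e2 := orb2_succ n r x
    have p1 : (0 : ℝ) ≤ ∑ j ∈ Finset.range r, (n j : ℝ) := by positivity
    have p2 : (0 : ℝ) ≤ n r := by positivity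
    have q1 := mul_le_mul_of_nonneg_left ha p1
    have q2 := mul_le_mul_of_nonneg_left ha p2
    have := h2 1
    nlinarith

lemma orb2_lim (n : ℕ → ℕ) (x : V) (h : x ∈ AF n) (hn : ∀ N, ∃ j, N ≤ j ∧ n j ≠ 0) :
    Tendsto (fun r => orb n r x 2) atTop (𝓝 0) := by
  have hN : Tendsto (fun r => ∑ j ∈ Finset.range r, n j) atTop atTop := by
    apply tendsto_atTop_atTop_of_monotone
    · intro a b hab
      exact Finset.sum_le_sum_of_subset (Finset.range_mono hab)
    · intro b
      induction b with
      | zero => exact ⟨0, Nat.zero_le _⟩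
      | succ b ih =>
        obtain ⟨r, hr⟩ := ih
        obtain ⟨j, hj, hj'⟩ := hn r
        refine ⟨j + 1, ?_⟩
        rw [Finset.sum_range_succ]
        have : ∑ j ∈ Finset.range r, n j ≤ ∑ i ∈ Finset.range j, n i :=
          Finset.sum_le_sum_of_subset (Finset.range_mono hj)
        omega
  have hN' : Tendsto (fun r => ((∑ j ∈ Finset.range r, n j : ℕ) : ℝ)) atTop atTop :=
    tendsto_natCast_atTop_atTop.comp hN
  have hl : Tendsto (fun r => (x 0 + x 1 + x 2) / ((∑ j ∈ Finset.range r, n j : ℕ) : ℝ)) atTop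
      (𝓝 0) := hN'.const_div_atTop _
  refine tendsto_of_tendsto_of_tendsto_of_le_of_le' tendsto_const_nhds hl
    (Eventually.of_forall fun r => h r 2) ?_
  filter_upwards [hN'.eventually_gt_atTop 0] with r hr
  rw [le_div_iff₀ hr]
  have := orb_sum_bound n x h r
  have := h r
  have h0 := this 0
  have h1 := this 1
  have h2 := this 2
  linarith

lemma AF_zero (n : ℕ → ℕ) (hn : ∀ s, n s = 0) (x : V) (h : x ∈ AF n) : x 0 = 0 ∧ x 1 = 0 := by
  have hk : ∀ k : ℕ, orb n (2 * k) x 0 = x 0 ∧ orb n (2 * k) x 1 = x 1 ∧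
      orb n (2 * k) x 2 = x 2 - k * (x 0 + x 1) := by
    intro k
    induction k with
    | zero => simp
    | succ k ih =>
      obtain ⟨a, b, c⟩ := ih
      rw [show 2 * (k + 1) = 2 * k + 1 + 1 by ring, orb_succ', orb_succ']
      simp [hn, a, b, c]
      ring
  have h0 : 0 ≤ x 0 := h 0 0
  have h1 : 0 ≤ x 1 := h 0 1
  have : x 0 + x 1 ≤ 0 := by
    by_contra hc
    push Not at hc
    obtain ⟨k, hk'⟩ := exists_nat_gt (x 2 / (x 0 + x 1))
    rw [div_lt_iff₀ hc] at hk'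
    have := h (2 * k) 2
    rw [(hk k).2.2] at this
    linarith
  constructor <;> linarith

lemma V_decomp (x : V) : x = x 0 • ![1, 0, 0] + x 1 • ![0, 1, 0] + x 2 • ![0, 0, 1] := by
  apply V_ext <;> simp

lemma KK_Qe2 (r : ℕ) : ∀ (m : NN) (_ : ∀ s, m.1 s ≠ ⊤),
    Qm (nn m) r ![0, 0, 1] - ![0, 0, 1] ∈ KK (SN 3 m) := by
  induction r with
  | zero => intro m _; simp
  | succ r ih =>
    intro m hm
    have h := KK_step m (hm 0) _ (ih (shN m) (fun s => hm (s + 1)))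
    have e : Qm (nn m) (r + 1) ![0, 0, 1] - ![0, 0, 1] =
        Mm (nn m 0) (Qm (nn (shN m)) r ![0, 0, 1] - ![0, 0, 1]) + (nn m 0 : ℝ) • ![1, 0, 0] := by
      have : Mm (nn m 0) ![0, 0, 1] = ![0, 0, 1] + (nn m 0 : ℝ) • ![1, 0, 0] := by
        apply V_ext <;> simp
      rw [map_sub, this, Qm_succ]
      show Mm (nn m 0) (Qm (nn (shN m)) r ![0, 0, 1]) - _ = _
      abel
    rw [e]
    exact add_mem h (KK_smul _ _ (Nat.cast_nonneg _) _ (KK_e0 m))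

lemma KK_e2 (m : NN) (hm : ∀ s, m.1 s ≠ ⊤) (hz : ∀ s, nn m s = 0) :
    (![0, 0, 1] : V) ∈ KK (SN 3 m) := by
  have hk : ∀ k : ℕ, ∀ (n : ℕ → ℕ) (_ : ∀ s, n s = 0),
      Qm n (2 * k) ![1, 0, 0] = ![1, 0, (k : ℝ)] := by
    intro k
    induction k with
    | zero => intro n _; simp
    | succ k ih =>
      intro n hn
      rw [show 2 * (k + 1) = 2 * k + 1 + 1 by ring, Qm_succ, Qm_succ, ih _ (fun s => hn _)]
      apply V_ext <;> simp [hn]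
      ring
  have hl : Tendsto (fun k : ℕ => ((k : ℝ)⁻¹) • (![1, 0, 0] : V) + ![0, 0, 1]) atTop
      (𝓝 ![0, 0, 1]) := by
    have := ((tendsto_inv_atTop_nhds_zero_nat (𝕜 := ℝ)).smul_const (![1, 0, 0] : V)).add_const
      (![0, 0, 1] : V)
    simpa using this
  refine (KK_closed _).mem_of_tendsto hl ?_
  filter_upwards [eventually_gt_atTop 0] with k hk0
  have h1 := KK_orb (2 * k) m (fun s _ => hm s) _ (KK_e0 _)
  rw [hk k _ hz] at h1
  have h2 := KK_smul _ ((k : ℝ)⁻¹) (by positivity) _ h1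
  have hk' : (k : ℝ) ≠ 0 := by exact_mod_cast hk0.ne'
  have e : ((k : ℝ)⁻¹) • (![1, 0, 0] : V) + ![0, 0, 1] = ((k : ℝ)⁻¹) • ![1, 0, (k : ℝ)] := by
    apply V_ext <;> simp [hk']
  rw [e]
  exact h2

lemma KK_AF (m : NN) (hm : ∀ s, m.1 s ≠ ⊤) (x : V) (hx : x ∈ AF (nn m)) : x ∈ KK (SN 3 m) := by
  have hQ : ∀ r, x = orb (nn m) r x 0 • Qm (nn m) r ![1, 0, 0] +
      orb (nn m) r x 1 • Qm (nn m) r ![0, 1, 0] + orb (nn m) r x 2 • Qm (nn m) r ![0, 0, 1] := by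
    intro r
    rw [← map_smul, ← map_smul, ← map_smul, ← map_add, ← map_add, ← V_decomp, Qm_orb]
  by_cases hn : ∀ N, ∃ j, N ≤ j ∧ nn m j ≠ 0
  · have hl := orb2_lim _ x hx hn
    have hl2 : Tendsto (fun r => x - orb (nn m) r x 2 • (![0, 0, 1] : V)) atTop (𝓝 x) := by
      have := (hl.smul_const (![0, 0, 1] : V)).const_sub x
      simpa using this
    refine (KK_closed _).mem_of_tendsto hl2 (Eventually.of_forall fun r => ?_)
    have e : x - orb (nn m) r x 2 • (![0, 0, 1] : V) = orb (nn m) r x 0 • Qm (nn m) r ![1, 0, 0] +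
      orb (nn m) r x 1 • Qm (nn m) r ![0, 1, 0] +
        orb (nn m) r x 2 • (Qm (nn m) r ![0, 0, 1] - ![0, 0, 1]) := by
      rw [smul_sub, ← add_sub_assoc, ← hQ r]
    simp only [SetLike.mem_coe]
    rw [e]
    exact add_mem (add_mem (KK_smul _ _ (hx r 0) _ (KK_orb r m (fun s _ => hm s) _ (KK_e0 _)))
      (KK_smul _ _ (hx r 1) _ (KK_orb r m (fun s _ => hm s) _ (KK_e1 _))))
      (KK_smul _ _ (hx r 2) _ (KK_Qe2 r m hm))
  · push Not at hn
    obtain ⟨R, hR⟩ := hn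
    have hz : ∀ s, nn (shN^[R] m) s = 0 := by
      intro s
      unfold nn
      rw [shN_iter]
      exact hR (R + s) (by omega)
    have hx' : orb (nn m) R x ∈ AF (fun s => nn m (R + s)) := by
      intro r i
      rw [← orb_add]; exact hx _ _
    obtain ⟨a, b⟩ := AF_zero _ (fun s => hR _ (by omega)) _ hx'
    rw [hQ R, a, b]
    simp only [zero_smul, zero_add]
    refine KK_smul _ _ (hx R 2) _ (KK_orb R m (fun s _ => hm s) _ (KK_e2 _ ?_ hz))
    intro s; rw [shN_iter]; exact hm _

lemma Dc_KK (m : NN) (x : V) (hx : x ∈ Dc m) (h2 : 0 ≤ x 2) : x ∈ KK (SN 3 m) := by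
  by_cases hf : ∃ R, m.1 R = ⊤
  · have hR := Nat.find_spec hf
    have hs : ∀ s, s < Nat.find hf → m.1 s ≠ ⊤ := fun s hs => Nat.find_min hf hs
    exact KK_neg _ m x hx h2 hs ((hx _ hs).2.2 hR)
  · push Not at hf
    by_cases hr : ∃ r, orb (nn m) r x 2 ≤ 0
    · obtain ⟨r, hr⟩ := hr
      exact KK_neg r m x hx h2 (fun s _ => hf s) hr
    · push Not at hr
      refine KK_AF m hf x fun r i => ?_
      obtain ⟨a, b, -⟩ := hx r (fun s _ => hf s)
      fin_cases i
      · exact a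
      · exact b
      · exact (hr r).le

/-! ### Realising frequencies -/

lemma lc_sum (u : List ℕ) (h : ∀ a ∈ u, a < 3) : lc u 0 + lc u 1 + lc u 2 = u.length := by
  induction u with
  | nil => simp [lc]
  | cons a u ih =>
    have ih' := ih (fun b hb => h b (List.mem_cons_of_mem _ hb))
    have e : a :: u = [a] ++ u := rfl
    rw [e, lc_append]
    have ha := h a (by simp)
    have : lc [a] 0 + lc [a] 1 + lc [a] 2 = 1 := by
      have : a = 0 ∨ a = 1 ∨ a = 2 := by omega
      rcases this with rfl | rfl | rfl <;> simp [lc]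
    simp only [Pi.add_apply, List.length_append, List.length_singleton]
    push_cast
    linarith

lemma lc_norm (u : List ℕ) : ‖lc u‖ ≤ u.length := by
  rw [pi_norm_le_iff_of_nonneg (by positivity)]
  intro i
  unfold lc
  rw [Real.norm_natCast]
  exact_mod_cast List.count_le_length

lemma exists_word (w : Seq) (x : V) (hx : x ∈ KK w) (hs : x 0 + x 1 + x 2 = 1) (ε : ℝ)
    (hε : 0 < ε) : ∃ u, u ≠ [] ∧ WW w u ∧ ‖lc u - (u.length : ℝ) • x‖ ≤ ε * u.length := by
  have hx' : x ∈ closure (K0 w : Set V) := hx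
  have hg : Continuous fun y : V => ‖y - (y 0 + y 1 + y 2) • x‖ := by fun_prop
  have hsum : Continuous fun y : V => y 0 + y 1 + y 2 := by fun_prop
  have hU : IsOpen {y : V | ‖y - (y 0 + y 1 + y 2) • x‖ < ε / 2 ∧ 1 / 2 < y 0 + y 1 + y 2} :=
    (isOpen_lt hg continuous_const).inter (isOpen_lt continuous_const hsum)
  obtain ⟨y, ⟨hy1, hy2⟩, k, hk, u, hu, h⟩ := mem_closure_iff.mp hx' _ hU
    ⟨by simp [hs]; exact hε, by rw [hs]; norm_num⟩
  have hk' : (0 : ℝ) < k := by exact_mod_cast hk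
  have hl : (u.length : ℝ) = k * (y 0 + y 1 + y 2) := by
    rw [← lc_sum u (WW_lt _ _ hu), ← h]; simp; ring
  refine ⟨u, ?_, hu, ?_⟩
  · rintro rfl
    simp only [List.length_nil, Nat.cast_zero] at hl
    have : 0 < (k : ℝ) * (y 0 + y 1 + y 2) := by apply mul_pos hk'; linarith
    linarith
  · have e : lc u - (u.length : ℝ) • x = (k : ℝ) • (y - (y 0 + y 1 + y 2) • x) := by
      rw [hl, ← h, smul_sub, smul_smul]
    rw [e, norm_smul, Real.norm_natCast, hl]
    calc (k : ℝ) * _ ≤ k * (ε / 2) := by gcongr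
      _ = ε * (k * (1 / 2)) := by ring
      _ ≤ _ := by gcongr

lemma blen_mono (f : ℕ → List ℕ) : Monotone (blen f) := fun a b hab =>
  Finset.sum_le_sum_of_subset (Finset.range_mono hab)

lemma le_blen (f : ℕ → List ℕ) (hf : ∀ r, f r ≠ []) (l : ℕ) : l ≤ blen f l := by
  induction l with
  | zero => simp
  | succ l ih =>
    have : 0 < (f l).length := List.length_pos_iff.mpr (hf l)
    have e : blen f (l + 1) = blen f l + (f l).length := Finset.sum_range_succ _ _
    omega

lemma exists_slow (c : ℕ → ℕ) : ∃ f : ℕ → ℕ, Tendsto f atTop atTop ∧ ∀ t, c (f t) * f t ≤ t := by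
  let P : ℕ → ℕ → Prop := fun t j => c j * j ≤ t
  refine ⟨fun t => Nat.findGreatest (P t) t, ?_, fun t => ?_⟩
  · rw [tendsto_atTop]
    intro J
    filter_upwards [eventually_ge_atTop (max J (c J * J))] with t ht
    exact Nat.le_findGreatest (le_trans (le_max_left _ _) ht) (le_trans (le_max_right _ _) ht)
  · exact Nat.findGreatest_spec (P := P t) (m := 0) (Nat.zero_le _) (by simp [P])

lemma exists_seq (w : Seq) (x : V) (hx : x ∈ KK w) (hx0 : ∀ i, 0 ≤ x i)
    (hs : x 0 + x 1 + x 2 = 1) :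
    ∃ v ∈ Xset 3 w, ∀ ε > 0, ∀ᶠ i : ℕ in atTop, ‖cnt v i - (i : ℝ) • x‖ ≤ ε * i := by
  have hnx : ‖x‖ ≤ 1 := by
    rw [pi_norm_le_iff_of_nonneg (by norm_num)]
    intro i
    rw [Real.norm_of_nonneg (hx0 i)]
    have h0 := hx0 0
    have h1 := hx0 1
    have h2 := hx0 2
    fin_cases i <;> simp <;> linarith
  choose u hu1 hu2 hu3 using fun j : ℕ => exists_word w x hx hs (1 / ((j : ℝ) + 1)) (by positivity)
  obtain ⟨f, hf1, hf2⟩ := exists_slow fun j => (u j).length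
  let g : ℕ → List ℕ := fun t => u (f t)
  have hg : ∀ t, g t ≠ [] := fun t => hu1 _
  refine ⟨concat g, concat_mem_Xset w g hg (fun t => hu2 _), fun ε hε => ?_⟩
  have hf1' : Tendsto (fun t => (f t : ℝ)) atTop atTop := tendsto_natCast_atTop_atTop.comp hf1
  have hlo : (fun t => lc (g t) - ((g t).length : ℝ) • x) =o[atTop] fun t => ((g t).length : ℝ) := by
    rw [Asymptotics.isLittleO_iff]
    intro c hc
    filter_upwards [hf1'.eventually_ge_atTop (1 / c)] with t ht
    rw [Real.norm_natCast]
    refine (hu3 (f t)).trans ?_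
    have : 1 / ((f t : ℝ) + 1) ≤ c := by
      rw [div_le_iff₀ (by positivity)]
      rw [div_le_iff₀ hc] at ht
      nlinarith
    exact mul_le_mul_of_nonneg_right this (by positivity)
  have hdiv : Tendsto (fun l => ∑ t ∈ Finset.range l, ((g t).length : ℝ)) atTop atTop := by
    have : ∀ l : ℕ, (l : ℝ) ≤ ∑ t ∈ Finset.range l, ((g t).length : ℝ) := by
      intro l
      have := le_blen g hg l
      unfold blen at this
      exact_mod_cast this
    exact tendsto_atTop_mono this tendsto_natCast_atTop_atTop
  have hsum := hlo.sum_range (fun t => by positivity) hdiv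
  rw [Asymptotics.isLittleO_iff] at hsum
  have h1 := hsum (half_pos hε)
  have h2 : ∀ᶠ l : ℕ in atTop, 2 * ((g l).length : ℝ) ≤ ε / 2 * l := by
    filter_upwards [hf1'.eventually_ge_atTop (4 / ε)] with l hl
    rw [div_le_iff₀ hε] at hl
    have h3 : ((g l).length : ℝ) * f l ≤ l := by exact_mod_cast hf2 l
    have h4 : (0 : ℝ) ≤ (g l).length := by positivity
    nlinarith
  obtain ⟨L, hL⟩ := eventually_atTop.mp (h1.and h2)
  filter_upwards [eventually_ge_atTop (blen g L)] with i hi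
  obtain ⟨l, j, hj, rfl⟩ := exists_block g hg i
  have hlL : L ≤ l := by
    by_contra hc
    push Not at hc
    have h5 := blen_mono g (show l + 1 ≤ L from hc)
    have e : blen g (l + 1) = blen g l + (g l).length := Finset.sum_range_succ _ _
    omega
  obtain ⟨hA, hB⟩ := hL l hlL
  rw [cnt_concat g hg l j hj.le]
  have hbl : ((blen g l : ℕ) : ℝ) = ∑ t ∈ Finset.range l, ((g t).length : ℝ) := by
    unfold blen; push_cast; rfl
  have e : ∑ t ∈ Finset.range l, lc (g t) + lc ((g l).take j) - ((blen g l + j : ℕ) : ℝ) • x =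
      ∑ t ∈ Finset.range l, (lc (g t) - ((g t).length : ℝ) • x) +
        (lc ((g l).take j) - (j : ℝ) • x) := by
    rw [Finset.sum_sub_distrib, ← Finset.sum_smul, ← hbl]
    push_cast
    rw [add_smul]
    abel
  rw [e]
  rw [← hbl, Real.norm_natCast] at hA
  have hj' : (j : ℝ) ≤ (g l).length := by exact_mod_cast hj.le
  have h3 : ‖lc ((g l).take j) - (j : ℝ) • x‖ ≤ 2 * (g l).length := by
    refine (norm_sub_le _ _).trans ?_
    have a1 := lc_norm ((g l).take j)
    have a2 : (((g l).take j).length : ℝ) ≤ (g l).length := by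
      exact_mod_cast (List.length_take_le j (g l)).trans hj.le
    have a3 : ‖(j : ℝ) • x‖ ≤ j := by
      rw [norm_smul, Real.norm_natCast]
      exact mul_le_of_le_one_right (by positivity) hnx
    linarith
  have h4 : (l : ℝ) ≤ blen g l := by exact_mod_cast le_blen g hg l
  refine (norm_add_le _ _).trans ?_
  push_cast
  have hj0 : (0 : ℝ) ≤ j := by positivity
  nlinarith

lemma DF_eq (m : NN) : DFN 3 m = {α : E 3 | α ∈ simplex 3 ∧ (fun i => α i) ∈ Dc m} := by
  ext α
  constructor
  · intro h; exact ⟨h.1, DF_subset m α h⟩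
  · rintro ⟨h1, h2⟩
    refine ⟨h1, ?_⟩
    have hs : α 0 + α 1 + α 2 = 1 := by
      have := h1.2; rwa [Fin.sum_univ_three] at this
    obtain ⟨v, hv, hlim⟩ := exists_seq (SN 3 m) (fun i => α i) (Dc_KK m _ h2 (h1.1 2)) h1.1 hs
    refine ⟨v, hv, ?_⟩
    intro d hd
    have e : proj α d = α ⟨d, hd⟩ := by simp [proj, hd]
    rw [e, Metric.tendsto_atTop']
    intro ε hε
    obtain ⟨N, hN⟩ := eventually_atTop.mp (hlim (ε / 2) (half_pos hε))
    refine ⟨N, fun i hi => ?_⟩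
    have h3 := (norm_le_pi_norm _ (⟨d, hd⟩ : Fin 3)).trans (hN i hi.le)
    have hi0 : (0 : ℝ) < i := by exact_mod_cast (by omega : 0 < i)
    rw [Real.dist_eq]
    have e2 : (digitCount v d i : ℝ) / i - α ⟨d, hd⟩ =
        (digitCount v d i - i * α ⟨d, hd⟩) / i := by field_simp
    rw [e2, abs_div, abs_of_pos hi0, div_lt_iff₀ hi0]
    refine lt_of_le_of_lt h3 ?_
    nlinarith

/-! ### Geometry of the digit frequency sets -/

/-- Coordinates. -/
noncomputable abbrev toV : E 3 ≃L[ℝ] V := EuclideanSpace.equiv (Fin 3) ℝ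

lemma toV_apply (α : E 3) (i : Fin 3) : toV α i = α i := rfl

lemma mem_simplex (α : E 3) : α ∈ simplex 3 ↔ (∀ i, 0 ≤ toV α i) ∧ toV α 0 + toV α 1 + toV α 2 = 1 := by
  unfold simplex
  rw [Set.mem_setOf_eq, Fin.sum_univ_three]
  rfl

/-- The digit frequency set in coordinates. -/
def DD (m : NN) : Set (E 3) := {α | α ∈ simplex 3 ∧ toV α ∈ Dc m}

lemma DFN_eq (m : NN) : DFN 3 m = DD m := DF_eq m

lemma simplex_compact : IsCompact (simplex 3) := by
  have e : simplex 3 = toV.toHomeomorph ⁻¹' (stdSimplex ℝ (Fin 3)) := by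
    ext α; rfl
  rw [e]
  exact toV.toHomeomorph.isCompact_preimage.mpr (isCompact_stdSimplex ℝ _)

lemma simplex_convex : Convex ℝ (simplex 3) := by
  have e : simplex 3 = toV.toLinearEquiv.toLinearMap ⁻¹' (stdSimplex ℝ (Fin 3)) := by
    ext α; rfl
  rw [e]
  exact (convex_stdSimplex ℝ _).linear_preimage _

lemma DD_compact (m : NN) : IsCompact (DD m) :=
  simplex_compact.inter_right ((Dc_closed m).preimage toV.continuous)

lemma DD_convex (m : NN) : Convex ℝ (DD m) := by
  intro x hx y hy a b ha hb hab
  refine ⟨simplex_convex hx.1 hy.1 ha hb hab, fun r => ?_⟩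
  rw [map_add, map_smul, map_smul]
  exact Cond_add (Cond_smul _ ha (hx.2 r)) (Cond_smul _ hb (hy.2 r))

/-- The vertex `e₀`. -/
noncomputable def E0 : E 3 := toV.symm ![1, 0, 0]

lemma toV_E0 : toV E0 = ![1, 0, 0] := toV.apply_symm_apply _

lemma E0_mem (m : NN) : E0 ∈ DD m := by
  refine ⟨?_, ?_⟩
  · rw [mem_simplex, toV_E0]
    refine ⟨fun i => ?_, by simp⟩
    fin_cases i <;> simp
  · intro r
    rw [toV_E0]
    exact Cond_of_Cminus r m (by simp [Cminus])

lemma EP_nonempty (m : NN) : (Set.extremePoints ℝ (DD m)).Nonempty :=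
  (DD_compact m).extremePoints_nonempty ⟨_, E0_mem m⟩

lemma EP_bounded (m : NN) : Bornology.IsBounded (Set.extremePoints ℝ (DD m)) :=
  (DD_compact m).isBounded.subset extremePoints_subset

lemma Dc_of (m : NN) (j : ℕ) (x : V) (hm : ∀ s, s < j → m.1 s ≠ ⊤)
    (hx : ∀ k, k ≤ j → 0 ≤ orb (nn m) k x 0 ∧ 0 ≤ orb (nn m) k x 1)
    (h2 : orb (nn m) j x 2 ≤ 0) : x ∈ Dc m := by
  intro k hk
  rcases lt_trichotomy k j with h | h | h
  · exact ⟨(hx k h.le).1, (hx k h.le).2, fun ht => absurd ht (hm k h)⟩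
  · subst h
    exact ⟨(hx k le_rfl).1, (hx k le_rfl).2, fun _ => h2⟩
  · obtain ⟨d, rfl⟩ := Nat.exists_eq_add_of_le h.le
    rw [orb_add]
    have hc : Cminus (orb (nn m) j x) := ⟨(hx j le_rfl).1, (hx j le_rfl).2, h2⟩
    obtain ⟨a, b, c⟩ := Cminus_orb d (fun s => nn m (j + s)) _ hc
    exact ⟨a, b, fun _ => c⟩

lemma Mm_nonneg (n : ℕ) (x : V) (h : ∀ i, 0 ≤ x i) : ∀ i, 0 ≤ Mm n x i := by
  have h0 := h 0
  have h1 := h 1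
  have h2 := h 2
  have hn : (0 : ℝ) ≤ n := Nat.cast_nonneg n
  intro i
  fin_cases i
  · simp; positivity
  · simpa using h0
  · simp; positivity

lemma Qm_nonneg (r : ℕ) : ∀ (n : ℕ → ℕ) (x : V), (∀ i, 0 ≤ x i) → ∀ i, 0 ≤ Qm n r x i := by
  induction r with
  | zero => intro n x h; exact h
  | succ r ih => intro n x h; rw [Qm_succ]; exact Mm_nonneg _ _ (ih _ _ h)

lemma orb_Qm_nonneg (r : ℕ) : ∀ (n : ℕ → ℕ) (x : V), (∀ i, 0 ≤ x i) → ∀ j, j ≤ r →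
    ∀ i, 0 ≤ orb n j (Qm n r x) i := by
  induction r with
  | zero =>
    intro n x h j hj
    have : j = 0 := by omega
    subst this; exact h
  | succ r ih =>
    intro n x h j hj
    cases j with
    | zero => exact Qm_nonneg (r + 1) n x h
    | succ j =>
      rw [orb_succ, Qm_succ, Mi_Mm]
      exact ih _ x h j (by omega)

/-- Normalisation to the simplex. -/
noncomputable def nrm (x : V) : E 3 := toV.symm ((x 0 + x 1 + x 2)⁻¹ • x)

lemma toV_nrm (x : V) : toV (nrm x) = (x 0 + x 1 + x 2)⁻¹ • x := toV.apply_symm_apply _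

lemma nrm_simplex (x : V) (h : ∀ i, 0 ≤ x i) (hx : x ≠ 0) : 0 < x 0 + x 1 + x 2 ∧ nrm x ∈ simplex 3 := by
  have h0 := h 0
  have h1 := h 1
  have h2 := h 2
  have hs : 0 < x 0 + x 1 + x 2 := by
    rcases (by positivity : 0 ≤ x 0 + x 1 + x 2).lt_or_eq with h | h
    · exact h
    · exfalso; apply hx; apply V_ext <;> simp <;> linarith
  refine ⟨hs, ?_⟩
  rw [mem_simplex, toV_nrm]
  refine ⟨fun i => mul_nonneg (by positivity) (h i), ?_⟩
  simp only [Pi.smul_apply, smul_eq_mul]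
  field_simp

lemma Qm_ne (n : ℕ → ℕ) (r : ℕ) (x : V) (hx : x ≠ 0) : Qm n r x ≠ 0 := by
  intro h
  apply hx
  rw [← orb_Qm r n x, h, map_zero]

/-- The nested simplices `A_r`. -/
def AA (n : ℕ → ℕ) (r : ℕ) : Set (E 3) :=
  {α | α ∈ simplex 3 ∧ ∀ j, j ≤ r → ∀ i, 0 ≤ orb n j (toV α) i}

lemma orb_cont (n : ℕ → ℕ) (r : ℕ) (i : Fin 3) : Continuous fun α : E 3 => orb n r (toV α) i :=
  (continuous_apply i).comp ((LinearMap.continuous_of_finiteDimensional _).comp toV.continuous)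

lemma AA_compact (n : ℕ → ℕ) (r : ℕ) : IsCompact (AA n r) := by
  refine simplex_compact.inter_right ?_
  have : {α : E 3 | ∀ j, j ≤ r → ∀ i, 0 ≤ orb n j (toV α) i} =
    ⋂ j, ⋂ (_ : j ≤ r), ⋂ i, {α : E 3 | 0 ≤ orb n j (toV α) i} := by
    ext α; simp
  show IsClosed {α : E 3 | ∀ j, j ≤ r → ∀ i, 0 ≤ orb n j (toV α) i}
  rw [this]
  exact isClosed_iInter fun j => isClosed_iInter fun _ => isClosed_iInter fun i =>
    isClosed_le continuous_const (orb_cont n j i)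

lemma AA_anti (n : ℕ → ℕ) : Antitone (AA n) := fun _ _ hab _ hx =>
  ⟨hx.1, fun j hj => hx.2 j (hj.trans hab)⟩

lemma AA_nonempty (n : ℕ → ℕ) (r : ℕ) : (AA n r).Nonempty := by
  have h0 : ∀ i, (0 : ℝ) ≤ (![1, 0, 0] : V) i := by intro i; fin_cases i <;> simp
  have hne : Qm n r ![1, 0, 0] ≠ 0 := Qm_ne n r _ (fun h => by simpa using congrFun h 0)
  obtain ⟨hs, h⟩ := nrm_simplex _ (Qm_nonneg r n _ h0) hne
  refine ⟨_, h, fun j hj i => ?_⟩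
  rw [toV_nrm, map_smul]
  exact mul_nonneg (by positivity) (orb_Qm_nonneg r n _ h0 j hj i)

/-- The limit set. -/
def AI (n : ℕ → ℕ) : Set (E 3) := {α | α ∈ simplex 3 ∧ toV α ∈ AF n}

lemma AI_eq (n : ℕ → ℕ) : AI n = ⋂ r, AA n r := by
  ext α
  rw [Set.mem_iInter]
  exact ⟨fun h r => ⟨h.1, fun j _ => h.2 j⟩, fun h => ⟨(h 0).1, fun j => (h j).2 j le_rfl⟩⟩

lemma AI_nonempty (n : ℕ → ℕ) : (AI n).Nonempty := by
  rw [AI_eq]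
  exact IsCompact.nonempty_iInter_of_sequence_nonempty_isCompact_isClosed _
    (fun i => AA_anti n (Nat.le_succ i)) (AA_nonempty n) (AA_compact n 0)
    (fun i => (AA_compact n i).isClosed)

/-! ### Continuity at regular points -/

lemma extreme_local {D D' U : Set (E 3)} (hD : Convex ℝ D') (hU : IsOpen U) {x : E 3}
    (hx : x ∈ Set.extremePoints ℝ D) (hxU : x ∈ U) (hxD : x ∈ D') (hsub : D' ∩ U ⊆ D) :
    x ∈ Set.extremePoints ℝ D' := by
  rw [mem_extremePoints] at hx ⊢
  refine ⟨hxD, fun y hy z hz hxyz => ?_⟩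
  have hc : ∀ y : E 3, ∀ᶠ t : ℝ in 𝓝[>] 0, x + t • (y - x) ∈ U := by
    intro y
    have : Continuous fun t : ℝ => x + t • (y - x) := by fun_prop
    have h0 := this.continuousAt (x := (0 : ℝ)) (hU.mem_nhds (by simpa using hxU))
    exact nhdsWithin_le_nhds h0
  have h1 : ∀ᶠ t : ℝ in 𝓝[>] 0, t ≤ 1 := nhdsWithin_le_nhds (Iic_mem_nhds one_pos)
  obtain ⟨t, hty, htz, ht1, ht0⟩ :=
    ((hc y).and ((hc z).and (h1.and self_mem_nhdsWithin))).exists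
  have ht0' : (0 : ℝ) < t := ht0
  have hconv : ∀ y ∈ D', x + t • (y - x) ∈ D' := by
    intro y hy
    have := hD hxD hy (sub_nonneg.mpr ht1) ht0'.le (by ring)
    convert this using 1
    module
  obtain ⟨a, b, ha, hb, hab, e⟩ := hxyz
  have := hx.2 _ (hsub ⟨hconv y hy, hty⟩) _ (hsub ⟨hconv z hz, htz⟩)
    ⟨a, b, ha, hb, hab, by
      have : a • (x + t • (y - x)) + b • (x + t • (z - x)) =
        (a + b) • x + t • (a • y + b • z - (a + b) • x) := by module
      rw [this, e, hab]; simp⟩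
  have key : ∀ y : E 3, x + t • (y - x) = x → y = x := by
    intro y h
    rw [add_eq_left, smul_eq_zero] at h
    rcases h with h | h
    · exact absurd h ht0'.ne'
    · exact sub_eq_zero.mp h
  exact ⟨key _ this.1, key _ this.2⟩

lemma EP_transfer (n : ℕ → ℕ) (r : ℕ) (m m' : NN) (hm : ∀ s, s < r → m.1 s = n s)
    (hm' : ∀ s, s < r → m'.1 s = n s) (x : E 3) (hx : x ∈ Set.extremePoints ℝ (DD m))
    (hxA : x ∉ AA n r) : x ∈ Set.extremePoints ℝ (DD m') := by
  have fin : ∀ m : NN, (∀ s, s < r → m.1 s = n s) → (∀ s, s < r → m.1 s ≠ ⊤) ∧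
      ∀ j, j ≤ r → orb (nn m) j = orb n j := by
    intro m hm
    refine ⟨fun s hs => by rw [hm s hs]; exact ENat.coe_ne_top _, fun j hj => ?_⟩
    refine orb_congr j _ _ (fun s hs => ?_)
    unfold nn; rw [hm s (by omega)]; rfl
  obtain ⟨f1, g1⟩ := fin m hm
  obtain ⟨f2, g2⟩ := fin m' hm'
  have hxD := extremePoints_subset hx
  have : ∃ j, j ≤ r ∧ orb n j (toV x) 2 < 0 := by
    by_contra hc
    push Not at hc
    refine hxA ⟨hxD.1, fun j hj i => ?_⟩
    obtain ⟨a, b, -⟩ := hxD.2 j (fun s hs => f1 s (by omega))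
    rw [g1 j hj] at a b
    fin_cases i
    · exact a
    · exact b
    · exact hc j hj
  obtain ⟨j, hj, hneg⟩ := this
  have hU : IsOpen {x : E 3 | orb n j (toV x) 2 < 0} := isOpen_lt (orb_cont n j 2) continuous_const
  have tr : ∀ m1 m2 : NN, (∀ s, s < r → m1.1 s = n s) → (∀ s, s < r → m2.1 s = n s) →
      DD m1 ∩ {x : E 3 | orb n j (toV x) 2 < 0} ⊆ DD m2 := by
    rintro m1 m2 h1 h2 y ⟨hy, hy2⟩
    obtain ⟨f1, g1⟩ := fin m1 h1
    obtain ⟨f2, g2⟩ := fin m2 h2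
    refine ⟨hy.1, Dc_of m2 j _ (fun s hs => f2 s (by omega)) (fun k hk => ?_) ?_⟩
    · obtain ⟨a, b, -⟩ := hy.2 k (fun s hs => f1 s (by omega))
      rw [g1 k (by omega)] at a b
      rw [g2 k (by omega)]
      exact ⟨a, b⟩
    · rw [g2 j hj]; exact le_of_lt hy2
  exact extreme_local (DD_convex m') hU hx hneg (tr m m' hm hm' ⟨hxD, hneg⟩) (tr m' m hm' hm)

lemma EP_meets (n : ℕ → ℕ) (r : ℕ) (m : NN) (hm : ∀ s, s < r → m.1 s = n s) :
    ∃ x ∈ Set.extremePoints ℝ (DD m), x ∈ AA n r := by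
  have f1 : ∀ s, s < r → m.1 s ≠ ⊤ := fun s hs => by rw [hm s hs]; exact ENat.coe_ne_top _
  have g1 : ∀ j, j ≤ r → orb (nn m) j = orb n j := by
    intro j hj
    refine orb_congr j _ _ (fun s hs => ?_)
    unfold nn; rw [hm s (by omega)]; rfl
  let l : E 3 →L[ℝ] ℝ := LinearMap.toContinuousLinearMap
    ((LinearMap.proj (R := ℝ) (φ := fun _ : Fin 3 => ℝ) 2).comp ((orb n r).comp
      toV.toLinearEquiv.toLinearMap))
  have hl : ∀ x, l x = orb n r (toV x) 2 := fun x => rfl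
  let F : Set (E 3) := {x ∈ DD m | ∀ y ∈ DD m, l y ≤ l x}
  have hF : IsExposed ℝ (DD m) F := fun _ => ⟨l, rfl⟩
  obtain ⟨x0, hx0, hmax⟩ := (DD_compact m).exists_isMaxOn ⟨_, E0_mem m⟩ l.continuous.continuousOn
  have hFn : F.Nonempty := ⟨x0, hx0, fun y hy => hmax hy⟩
  obtain ⟨x, hx⟩ := (hF.isCompact (DD_compact m)).extremePoints_nonempty hFn
  have hxF := extremePoints_subset hx
  refine ⟨x, hF.isExtreme.extremePoints_subset_extremePoints hx, hxF.1.1, ?_⟩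
  have h0 : ∀ i, (0 : ℝ) ≤ (![1, 0, 0] : V) i := by intro i; fin_cases i <;> simp
  have hne : Qm n r ![1, 0, 0] ≠ 0 := Qm_ne n r _ (fun h => by simpa using congrFun h 0)
  obtain ⟨hs, h⟩ := nrm_simplex _ (Qm_nonneg r n _ h0) hne
  have hp : nrm (Qm n r ![1, 0, 0]) ∈ DD m := by
    refine ⟨h, Dc_of m r _ f1 (fun k hk => ?_) ?_⟩
    · rw [g1 k hk, toV_nrm, map_smul]
      exact ⟨mul_nonneg (by positivity) (orb_Qm_nonneg r n _ h0 k hk 0),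
        mul_nonneg (by positivity) (orb_Qm_nonneg r n _ h0 k hk 1)⟩
    · rw [g1 r le_rfl, toV_nrm, map_smul, orb_Qm]; simp
  have hpos : 0 ≤ orb n r (toV x) 2 := by
    have := hxF.2 _ hp
    rw [hl, hl, toV_nrm, map_smul, orb_Qm] at this
    simpa using this
  have hx01 : ∀ j, j ≤ r → 0 ≤ orb n j (toV x) 0 ∧ 0 ≤ orb n j (toV x) 1 := by
    intro j hj
    obtain ⟨a, b, -⟩ := hxF.1.2 j (fun s hs => f1 s (by omega))
    rw [g1 j hj] at a b
    exact ⟨a, b⟩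
  have hdec : ∀ d, d ≤ r → 0 ≤ orb n (r - d) (toV x) 2 := by
    intro d
    induction d with
    | zero => intro _; exact hpos
    | succ d ih =>
      intro hd
      have h1 := ih (by omega)
      have h2 := orb2_succ n (r - (d + 1)) (toV x)
      rw [show r - (d + 1) + 1 = r - d by omega] at h2
      have := (hx01 (r - d) (by omega)).2
      linarith
  intro j hj i
  fin_cases i
  · exact (hx01 j hj).1
  · exact (hx01 j hj).2
  · have := hdec (r - j) (by omega)
    rwa [show r - (r - j) = j by omega] at this

lemma dN_agree (m : NN) (hm : ∀ s, m.1 s ≠ ⊤) (r : ℕ) :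
    ∃ δ > (0 : ℝ), ∀ m' : NN, dN m' m < δ → ∀ s, s < r → m'.1 s = m.1 s := by
  let B := ∑ s ∈ Finset.range r, nn m s
  refine ⟨(2 : ℝ) ^ (-((r : ℤ) + (B : ℤ))), by positivity, fun m' hd => ?_⟩
  by_contra hc
  push Not at hc
  obtain ⟨s, hs, hne⟩ := hc
  have hmm : m' ≠ m := fun h => hne (by rw [h])
  unfold dN at hd
  rw [dif_neg hmm] at hd
  refine absurd hd (not_lt.mpr ?_)
  apply zpow_le_zpow_right₀ (by norm_num)
  have hex : ∃ r, m'.1 r ≠ m.1 r := ⟨s, hne⟩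
  have hq : Nat.find hex ≤ s := Nat.find_min' hex hne
  have hsum : ∑ s ∈ Finset.range (Nat.find hex + 1), m.1 s =
      ((∑ s ∈ Finset.range (Nat.find hex + 1), nn m s : ℕ) : ℕ∞) := by
    push_cast
    refine Finset.sum_congr rfl fun s _ => ?_
    exact (ENat.coe_toNat (hm s)).symm
  have h1 : (min (∑ s ∈ Finset.range (Nat.find hex + 1), m'.1 s)
      (∑ s ∈ Finset.range (Nat.find hex + 1), m.1 s)).toNat ≤ B := by
    have h2 : min (∑ s ∈ Finset.range (Nat.find hex + 1), m'.1 s)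
      (∑ s ∈ Finset.range (Nat.find hex + 1), m.1 s) ≤
        ((∑ s ∈ Finset.range (Nat.find hex + 1), nn m s : ℕ) : ℕ∞) := by
      rw [← hsum]; exact min_le_right _ _
    refine (ENat.toNat_le_of_le_coe h2).trans ?_
    exact Finset.sum_le_sum_of_subset (Finset.range_mono (by omega))
  have h3 : Nat.find hex ≤ r := by omega
  apply neg_le_neg
  exact_mod_cast add_le_add h3 h1

lemma cont_regular (m : NN) (hm : ∀ s, m.1 s ≠ ⊤) (L : E 3) (hL : AI (nn m) = {L}) (ε : ℝ)
    (hε : 0 < ε) : ∃ δ > (0 : ℝ), ∀ m' : NN, dN m' m < δ →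
      Metric.hausdorffDist (Set.extremePoints ℝ (DD m')) (Set.extremePoints ℝ (DD m)) < ε := by
  obtain ⟨r, hr⟩ := exists_subset_nhds_of_isCompact' (V := AA (nn m))
    (directed_of_isDirected_le fun a b hab => AA_anti (nn m) hab) (AA_compact (nn m))
    (fun i => (AA_compact (nn m) i).isClosed) (U := Metric.ball L (ε / 4)) (by
      rw [← AI_eq, hL]
      rintro x rfl
      exact Metric.ball_mem_nhds _ (by linarith))
  obtain ⟨δ, hδ, h⟩ := dN_agree m hm r
  refine ⟨δ, hδ, fun m' hd => ?_⟩
  have ha : ∀ s, s < r → m.1 s = nn m s := fun s _ => (ENat.coe_toNat (hm s)).symm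
  have hb : ∀ s, s < r → m'.1 s = nn m s := fun s hs => (h m' hd s hs).trans (ha s hs)
  have key : ∀ m1 m2 : NN, (∀ s, s < r → m1.1 s = nn m s) → (∀ s, s < r → m2.1 s = nn m s) →
      ∀ x ∈ Set.extremePoints ℝ (DD m1), ∃ y ∈ Set.extremePoints ℝ (DD m2), dist x y ≤ ε / 2 := by
    intro m1 m2 h1 h2 x hx
    by_cases hxA : x ∈ AA (nn m) r
    · obtain ⟨y, hy, hyA⟩ := EP_meets (nn m) r m2 h2
      refine ⟨y, hy, ?_⟩
      have a1 := hr hxA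
      have a2 := hr hyA
      rw [Metric.mem_ball] at a1 a2
      have := dist_triangle_right x y L
      linarith
    · exact ⟨x, EP_transfer (nn m) r m1 m2 h1 h2 x hx hxA, by rw [dist_self]; linarith⟩
  refine lt_of_le_of_lt (Metric.hausdorffDist_le_of_mem_dist (r := ε / 2) (by linarith)
    (key m' m hb ha) (key m m' ha hb)) (by linarith)

/-! ### The fibers of the itinerary map -/

lemma orb_sum_step (n : ℕ) (x : V) : Mi n x 0 + Mi n x 1 + Mi n x 2 = x 1 + x 2 := by
  simp; ring

lemma AF_shift (n : ℕ → ℕ) (x : V) (h : x ∈ AF n) : Mi (n 0) x ∈ AF (fun s => n (s + 1)) :=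
  fun r i => h (r + 1) i

lemma AF_cons (n : ℕ → ℕ) (x : V) (h0 : ∀ i, 0 ≤ x i) (h : Mi (n 0) x ∈ AF (fun s => n (s + 1))) :
    x ∈ AF n := by
  intro r
  cases r with
  | zero => exact h0
  | succ r => exact h r

lemma AF_smul (n : ℕ → ℕ) (x : V) (t : ℝ) (ht : 0 ≤ t) (h : x ∈ AF n) : t • x ∈ AF n := by
  intro r i
  rw [map_smul]; exact mul_nonneg ht (h r i)

lemma AF_pos (n : ℕ → ℕ) (x : V) (h : x ∈ AF n) (hs : 0 < x 0 + x 1 + x 2) : 0 < x 2 := by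
  have a0 : 0 ≤ x 0 := h 0 0
  have a1 : 0 ≤ x 1 := h 0 1
  have a2 : 0 ≤ x 2 := h 0 2
  rcases a2.lt_or_eq with h2 | h2
  · exact h2
  exfalso
  have b := h 1 2
  rw [orb_succ'] at b
  simp [← h2] at b
  have c := h 2 2
  rw [orb_succ', orb_succ'] at c
  simp [← h2] at c
  have e : x 0 = 0 := by linarith
  rw [e] at c
  simp at c
  linarith

lemma proj3 (α : E 3) : proj α 0 = toV α 0 ∧ proj α 1 = toV α 1 ∧ proj α 2 = toV α 2 := by
  simp [proj]

lemma toV_Kmap (n : ℕ) (α : E 3) : toV (Kmap n α) = (1 - toV α 0)⁻¹ • Mi n (toV α) := by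
  obtain ⟨h0, h1, h2⟩ := proj3 α
  have e : toV (Kmap n α) = fun i : Fin 3 => if (i : ℕ) + 2 < 3 then proj α ((i : ℕ) + 1) / (1 - proj α 0)
    else if (i : ℕ) + 2 = 3 then (proj α 0 - n * proj α (3 - 1)) / (1 - proj α 0)
    else ((n + 1) * proj α (3 - 1) - proj α 0) / (1 - proj α 0) := rfl
  rw [e]
  apply V_ext
  · simp only [Pi.smul_apply, Mi_0, smul_eq_mul]
    rw [← h0, ← h1]
    simp [div_eq_inv_mul]
  · simp only [Pi.smul_apply, Mi_1, smul_eq_mul]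
    rw [← h0, ← h2]
    simp [div_eq_inv_mul]
  · simp only [Pi.smul_apply, Mi_2, smul_eq_mul]
    rw [← h0, ← h2]
    simp [div_eq_inv_mul]

lemma mem_simplex' (α : E 3) : α ∈ simplex' 3 ↔ α ∈ simplex 3 ∧ 0 < toV α 2 := by
  unfold simplex' faceF
  obtain ⟨h0, h1, h2⟩ := proj3 α
  constructor
  · rintro ⟨h, h'⟩
    refine ⟨h, lt_of_le_of_ne (h.1 2) fun hc => h' ⟨h, ?_⟩⟩
    show proj α 2 = 0
    rw [h2]; exact hc.symm
  · rintro ⟨h, h'⟩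
    refine ⟨h, fun hc => ?_⟩
    have : proj α 2 = 0 := hc.2
    rw [h2] at this
    linarith

lemma Jfun_bounds (α : E 3) (h : α ∈ simplex' 3) :
    (Jfun α : ℝ) * toV α 2 ≤ toV α 0 ∧ toV α 0 < (Jfun α + 1) * toV α 2 := by
  obtain ⟨h0, h1, h2⟩ := proj3 α
  obtain ⟨hs, hp⟩ := (mem_simplex' α).mp h
  have e : Jfun α = ⌊toV α 0 / toV α 2⌋₊ := by
    unfold Jfun; rw [h0]
    show ⌊_ / proj α 2⌋₊ = _
    rw [h2]
  rw [e]
  have hd : 0 ≤ toV α 0 / toV α 2 := div_nonneg (hs.1 0) hp.le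
  constructor
  · rw [← le_div_iff₀ hp]; exact Nat.floor_le hd
  · rw [← div_lt_iff₀ hp]; exact Nat.lt_floor_add_one _

lemma Jfun_eq (α : E 3) (n : ℕ) (h : α ∈ simplex' 3) (h1 : (n : ℝ) * toV α 2 ≤ toV α 0)
    (h2 : toV α 0 < (n + 1) * toV α 2) : Jfun α = n := by
  obtain ⟨a, b⟩ := Jfun_bounds α h
  have hp := ((mem_simplex' α).mp h).2
  have c1 : (n : ℝ) < Jfun α + 1 := by
    by_contra hc; push Not at hc
    have := mul_le_mul_of_nonneg_right hc hp.le
    linarith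
  have c2 : (Jfun α : ℝ) < n + 1 := by
    by_contra hc; push Not at hc
    have := mul_le_mul_of_nonneg_right hc hp.le
    linarith
  have c1' : n < Jfun α + 1 := by exact_mod_cast c1
  have c2' : Jfun α < n + 1 := by exact_mod_cast c2
  omega

lemma toV_Kstep (α : E 3) : toV (Kstep α) = (1 - toV α 0)⁻¹ • Mi (Jfun α) (toV α) := toV_Kmap _ _

lemma Kstep_mem (α : E 3) (h : α ∈ simplex' 3) : Kstep α ∈ simplex' 3 ∧ 0 < 1 - toV α 0 := by
  obtain ⟨hs, hp⟩ := (mem_simplex' α).mp h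
  obtain ⟨hn, h1⟩ := (mem_simplex α).mp hs
  obtain ⟨a, b⟩ := Jfun_bounds α h
  have q : 0 < 1 - toV α 0 := by have := hn 1; linarith
  refine ⟨?_, q⟩
  rw [mem_simplex', mem_simplex, toV_Kstep]
  refine ⟨⟨fun i => ?_, ?_⟩, ?_⟩
  · apply mul_nonneg (inv_nonneg.mpr q.le)
    fin_cases i
    · exact hn 1
    · show 0 ≤ Mi (Jfun α) (toV α) 1
      rw [Mi_1]; linarith
    · show 0 ≤ Mi (Jfun α) (toV α) 2
      rw [Mi_2]; linarith
  · have := orb_sum_step (Jfun α) (toV α)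
    simp only [Pi.smul_apply, smul_eq_mul]
    rw [← mul_add, ← mul_add, this]
    have e : toV α 1 + toV α 2 = 1 - toV α 0 := by linarith
    rw [e]; exact inv_mul_cancel₀ q.ne'
  · simp only [Pi.smul_apply, smul_eq_mul]
    apply mul_pos (inv_pos.mpr q)
    rw [Mi_2]; linarith

lemma Phi_AF (r : ℕ) : ∀ α : E 3, α ∈ simplex' 3 → ∀ i, 0 ≤ orb (Phi α) r (toV α) i := by
  induction r with
  | zero => intro α h; exact ((mem_simplex α).mp h.1).1
  | succ r ih =>
    intro α h i
    obtain ⟨hk, q⟩ := Kstep_mem α h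
    have e : (fun s => Phi α (s + 1)) = Phi (Kstep α) := rfl
    rw [orb_succ, e]
    have e2 : Mi (Phi α 0) (toV α) = (1 - toV α 0) • toV (Kstep α) := by
      rw [toV_Kstep, smul_smul, mul_inv_cancel₀ q.ne', one_smul]; rfl
    rw [e2, map_smul]
    exact mul_nonneg q.le (ih _ hk i)

lemma AF_Phi (r : ℕ) : ∀ (n : ℕ → ℕ) (α : E 3), α ∈ AI n → α ∈ simplex' 3 ∧ Phi α r = n r := by
  have step : ∀ (n : ℕ → ℕ) (α : E 3), α ∈ AI n → α ∈ simplex' 3 ∧ Jfun α = n 0 ∧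
      Kstep α ∈ AI (fun s => n (s + 1)) := by
    intro n α h
    have hs := (mem_simplex α).mp h.1
    have hp := AF_pos n _ h.2 (by rw [hs.2]; norm_num)
    have h' : α ∈ simplex' 3 := (mem_simplex' α).mpr ⟨h.1, hp⟩
    have hsh := AF_shift n _ h.2
    have hp' := AF_pos _ _ hsh (by rw [orb_sum_step]; have := hs.1 1; linarith)
    have h1 := hsh 0 1
    rw [orb_zero, Mi_1] at h1
    rw [Mi_2] at hp'
    have hJ := Jfun_eq α (n 0) h' (by linarith) (by linarith)
    obtain ⟨hk, q⟩ := Kstep_mem α h'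
    refine ⟨h', hJ, hk.1, ?_⟩
    rw [toV_Kstep, hJ]
    exact AF_smul _ _ _ (inv_nonneg.mpr q.le) hsh
  induction r with
  | zero => intro n α h; exact ⟨(step n α h).1, (step n α h).2.1⟩
  | succ r ih =>
    intro n α h
    obtain ⟨a, b, c⟩ := step n α h
    exact ⟨a, (ih _ _ c).2⟩

lemma fiber_eq (n : ℕ → ℕ) : PhiFiber 3 n = AI n := by
  ext α
  constructor
  · rintro ⟨h1, h2⟩
    refine ⟨h1.1, fun r i => ?_⟩
    rw [← h2]; exact Phi_AF r α h1 i
  · intro h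
    exact ⟨(AF_Phi 0 n α h).1, funext fun r => (AF_Phi r n α h).2⟩

/-! ### Rational extreme points -/

lemma int_orbit (N : ℕ) : ∀ a b c : ℕ, 2 * (a + b + c) + (if a = 0 then 1 else 0) ≤ N → 0 < c →
    ∃ g : ℕ → ℕ, (![(a : ℝ), b, c] : V) ∈ AF g ∧ g 0 = a / c ∧
      ∃ r, orb g r ![(a : ℝ), b, c] 0 = 0 ∧ orb g r ![(a : ℝ), b, c] 1 = 0 := by
  induction N with
  | zero => intro a b c h hc; omega
  | succ N ih =>
    intro a b c h hc
    have hnn : ∀ i, 0 ≤ (![(a : ℝ), b, c] : V) i := by intro i; fin_cases i <;> simp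
    by_cases hab : a = 0 ∧ b = 0
    · obtain ⟨rfl, rfl⟩ := hab
      refine ⟨fun _ => 0, ?_, by simp, 0, by simp, by simp⟩
      have : ∀ r, orb (fun _ => 0) r ![((0 : ℕ) : ℝ), (0 : ℕ), c] = ![((0 : ℕ) : ℝ), (0 : ℕ), c] := by
        intro r
        induction r with
        | zero => rfl
        | succ r ih => rw [orb_succ', ih]; apply V_ext <;> simp
      intro r i
      rw [this]; exact hnn i
    · have hlt : a % c < c := Nat.mod_lt _ hc
      have hmod : c * (a / c) + a % c = a := Nat.div_add_mod a c
      have hle : a % c ≤ a := Nat.mod_le _ _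
      obtain ⟨g, h1, h2, r, h3, h4⟩ := ih b (a % c) (c - a % c) (by
        split_ifs at h ⊢ <;> omega) (by omega)
      have e : Mi (a / c) ![(a : ℝ), b, c] = ![(b : ℝ), (a % c : ℕ), (c - a % c : ℕ)] := by
        have hr : (c : ℝ) * (a / c : ℕ) + (a % c : ℕ) = a := by exact_mod_cast hmod
        apply V_ext
        · simp
        · simp only [Mi_1, Matrix.cons_val_zero, Matrix.cons_val_one, Matrix.cons_val]
          linarith
        · rw [Nat.cast_sub hlt.le]
          simp only [Mi_2, Matrix.cons_val_zero, Matrix.cons_val]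
          linarith
      let g' : ℕ → ℕ := fun s => Nat.casesOn s (a / c) g
      refine ⟨g', AF_cons g' _ hnn ?_, rfl, r + 1, ?_, ?_⟩
      · show Mi (a / c) _ ∈ AF g
        rw [e]; exact h1
      · show orb g r (Mi (a / c) _) 0 = 0
        rw [e]; exact h3
      · show orb g r (Mi (a / c) _) 1 = 0
        rw [e]; exact h4

lemma int_prepend (R : ℕ) : ∀ (n : ℕ → ℕ) (a b c : ℕ), 0 < c →
    ∃ g : ℕ → ℕ, (∀ s, s < R → g s = n s) ∧ g R = a / c ∧ Qm n R ![(a : ℝ), b, c] ∈ AF g ∧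
      ∃ r, orb g r (Qm n R ![(a : ℝ), b, c]) 0 = 0 ∧ orb g r (Qm n R ![(a : ℝ), b, c]) 1 = 0 := by
  induction R with
  | zero =>
    intro n a b c hc
    obtain ⟨g, h1, h2, h3⟩ := int_orbit _ a b c le_rfl hc
    exact ⟨g, fun s hs => absurd hs (by omega), h2, h1, h3⟩
  | succ R ih =>
    intro n a b c hc
    obtain ⟨g, h0, h1, h2, r, h3, h4⟩ := ih (fun s => n (s + 1)) a b c hc
    have hnn : ∀ i, 0 ≤ (![(a : ℝ), b, c] : V) i := by intro i; fin_cases i <;> simp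
    let g' : ℕ → ℕ := fun s => Nat.casesOn s (n 0) g
    have e : Mi (n 0) (Qm n (R + 1) ![(a : ℝ), b, c]) = Qm (fun s => n (s + 1)) R ![(a : ℝ), b, c] := by
      rw [Qm_succ, Mi_Mm]
    refine ⟨g', ?_, h1, AF_cons g' _ (Qm_nonneg _ _ _ hnn) ?_, r + 1, ?_, ?_⟩
    · intro s hs
      cases s with
      | zero => rfl
      | succ s => exact h0 s (by omega)
    · show Mi (n 0) _ ∈ AF g
      rw [e]; exact h2
    · show orb g r (Mi (n 0) _) 0 = 0
      rw [e]; exact h3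
    · show orb g r (Mi (n 0) _) 1 = 0
      rw [e]; exact h4

lemma AF_Dc (g : ℕ → ℕ) (x : V) (h : x ∈ AF g) : x ∈ Dc (toNN g) := by
  intro r _
  exact ⟨h r 0, h r 1, fun ht => absurd ht (ENat.coe_ne_top _)⟩

lemma simplex_prop (x y : E 3) (t : ℝ) (hx : x ∈ simplex 3) (hy : y ∈ simplex 3)
    (h : toV y = t • toV x) : y = x := by
  rw [mem_simplex] at hx hy
  have : t = 1 := by
    have h2 := hy.2
    rw [h] at h2
    simp only [Pi.smul_apply, smul_eq_mul] at h2
    rw [← mul_add, ← mul_add, hx.2, mul_one] at h2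
    exact h2
  rw [this, one_smul] at h
  exact toV.injective h

lemma prop_of_zero (g : ℕ → ℕ) (r : ℕ) (x y : E 3) (hx : x ∈ simplex 3) (hy : y ∈ simplex 3)
    (x0 : orb g r (toV x) 0 = 0) (x1 : orb g r (toV x) 1 = 0)
    (y0 : orb g r (toV y) 0 = 0) (y1 : orb g r (toV y) 1 = 0) : y = x := by
  have hx2 : orb g r (toV x) 2 ≠ 0 := by
    intro hc
    have : orb g r (toV x) = 0 := V_ext x0 x1 hc
    have h0 : toV x = 0 := by rw [← Qm_orb r g (toV x), this, map_zero]
    have := ((mem_simplex x).mp hx).2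
    rw [h0] at this
    simp at this
  refine simplex_prop x y (orb g r (toV y) 2 / orb g r (toV x) 2) hx hy ?_
  rw [← Qm_orb r g (toV x), ← Qm_orb r g (toV y), ← map_smul, orb_Qm, orb_Qm]
  congr 1
  apply V_ext
  · simp [x0, y0]
  · simp [x1, y1]
  · simp [hx2]

lemma rat_extreme (g : ℕ → ℕ) (x : E 3) (hx : x ∈ AI g) (r : ℕ)
    (h0 : orb g r (toV x) 0 = 0) (h1 : orb g r (toV x) 1 = 0) :
    x ∈ Set.extremePoints ℝ (DD (toNN g)) := by
  refine ⟨⟨hx.1, AF_Dc g _ hx.2⟩, ?_⟩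
  rintro y hy z hz ⟨a, b, ha, hb, hab, e⟩
  have hc : ∀ y ∈ DD (toNN g), 0 ≤ orb g r (toV y) 0 ∧ 0 ≤ orb g r (toV y) 1 := by
    intro y hy
    obtain ⟨p, q, -⟩ := hy.2 r (fun s _ => ENat.coe_ne_top _)
    exact ⟨p, q⟩
  obtain ⟨y0, y1⟩ := hc y hy
  obtain ⟨z0, z1⟩ := hc z hz
  rw [← e, map_add, map_smul, map_smul, map_add, map_smul, map_smul] at h0 h1
  simp only [Pi.add_apply, Pi.smul_apply, smul_eq_mul] at h0 h1
  have y0' : orb g r (toV y) 0 = 0 := by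
    have := mul_nonneg hb.le z0
    have := mul_nonneg ha.le y0
    have : a * orb g r (toV y) 0 = 0 := by linarith
    rcases mul_eq_zero.mp this with h | h
    · exact absurd h ha.ne'
    · exact h
  have y1' : orb g r (toV y) 1 = 0 := by
    have := mul_nonneg hb.le z1
    have := mul_nonneg ha.le y1
    have : a * orb g r (toV y) 1 = 0 := by linarith
    rcases mul_eq_zero.mp this with h | h
    · exact absurd h ha.ne'
    · exact h
  have hx0 : orb g r (toV x) 0 = 0 := by
    rw [← e, map_add, map_smul, map_smul, map_add, map_smul, map_smul]; exact h0
  have hx1 : orb g r (toV x) 1 = 0 := by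
    rw [← e, map_add, map_smul, map_smul, map_add, map_smul, map_smul]; exact h1
  exact prop_of_zero g r x y hx.1 hy.1 hx0 hx1 y0' y1'

/-- Approximation of points of the simplex by rational extreme points. -/
lemma rat_approx (n : ℕ → ℕ) (R : ℕ) (μ : E 3) (hμ : μ ∈ simplex 3) (y : V) (hy : ∀ i, 0 ≤ y i)
    (e : toV μ = Qm n R y) (η : ℝ) (hη : 0 < η) : ∀ᶠ k : ℕ in atTop, ∃ g : ℕ → ℕ,
      (∀ s, s < R → g s = n s) ∧ g R = ⌊(y 0) * k⌋₊ / (⌊(y 2) * k⌋₊ + 1) ∧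
      ∃ p ∈ Set.extremePoints ℝ (DD (toNN g)), dist p μ < η := by
  let β : ℕ → V := fun k => ![(⌊y 0 * k⌋₊ : ℝ), ⌊y 1 * k⌋₊, (⌊y 2 * k⌋₊ + 1 : ℕ)]
  have hβ : Tendsto (fun k : ℕ => ((k : ℝ)⁻¹) • β k) atTop (𝓝 y) := by
    have fl : ∀ t : ℝ, 0 ≤ t → Tendsto (fun k : ℕ => ((k : ℝ)⁻¹) * (⌊t * k⌋₊ : ℝ)) atTop (𝓝 t) := by
      intro t ht
      have := (tendsto_nat_floor_mul_div_atTop ht).comp (tendsto_natCast_atTop_atTop (R := ℝ))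
      refine this.congr fun k => ?_
      simp [div_eq_inv_mul]
    rw [tendsto_pi_nhds]
    intro i
    fin_cases i
    · exact fl _ (hy 0)
    · exact fl _ (hy 1)
    · have := (fl _ (hy 2)).add (tendsto_inv_atTop_nhds_zero_nat (𝕜 := ℝ))
      rw [add_zero] at this
      refine this.congr fun k => ?_
      simp [β]; ring
  have hsum := ((mem_simplex μ).mp hμ).2
  have hcont : ContinuousAt (fun x : V => nrm (Qm n R x)) y := by
    have hq : Continuous (Qm n R) := LinearMap.continuous_of_finiteDimensional _
    have hqi : ∀ i, Continuous fun x => Qm n R x i := fun i => (continuous_apply i).comp hq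
    have h1 : ContinuousAt (fun x : V => Qm n R x 0 + Qm n R x 1 + Qm n R x 2) y :=
      (((hqi 0).add (hqi 1)).add (hqi 2)).continuousAt
    have h2 : ContinuousAt (fun x : V => (Qm n R x 0 + Qm n R x 1 + Qm n R x 2)⁻¹) y :=
      h1.inv₀ (by rw [← e, hsum]; norm_num)
    have h3 : ContinuousAt (fun x : V => (Qm n R x 0 + Qm n R x 1 + Qm n R x 2)⁻¹ • Qm n R x) y :=
      h2.smul hq.continuousAt
    exact ContinuousAt.comp (g := toV.symm) toV.symm.continuous.continuousAt h3
  have hlim := hcont.tendsto.comp hβ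
  have hval : nrm (Qm n R y) = μ := by
    apply toV.injective
    rw [toV_nrm, ← e, hsum]; simp
  rw [hval] at hlim
  have hev := Metric.tendsto_nhds.mp hlim η hη
  filter_upwards [hev, eventually_gt_atTop 0] with k hk hk0
  obtain ⟨g, h1, h2, h3, r, h4, h5⟩ := int_prepend R n ⌊y 0 * k⌋₊ ⌊y 1 * k⌋₊ (⌊y 2 * k⌋₊ + 1) (by omega)
  refine ⟨g, h1, h2, nrm (Qm n R (β k)), ?_, ?_⟩
  · have hb : ∀ i, 0 ≤ β k i := by
      intro i; fin_cases i <;> simp [β]; positivity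
    have hb0 : β k ≠ 0 := by
      intro h
      have := congrFun h 2
      simp [β] at this
      have h6 : (0 : ℝ) ≤ ⌊y 2 * k⌋₊ := by positivity
      linarith
    obtain ⟨hs, hsx⟩ := nrm_simplex _ (Qm_nonneg R n _ hb) (Qm_ne n R _ hb0)
    have e3 := toV_nrm (Qm n R (β k))
    refine rat_extreme g _ ⟨hsx, ?_⟩ r ?_ ?_
    · rw [e3]; exact AF_smul _ _ _ (inv_nonneg.mpr hs.le) h3
    · rw [e3, map_smul, Pi.smul_apply]
      show _ • orb g r (Qm n R ![(⌊y 0 * k⌋₊ : ℝ), ⌊y 1 * k⌋₊, (⌊y 2 * k⌋₊ + 1 : ℕ)]) 0 = 0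
      rw [h4]; simp
    · rw [e3, map_smul, Pi.smul_apply]
      show _ • orb g r (Qm n R ![(⌊y 0 * k⌋₊ : ℝ), ⌊y 1 * k⌋₊, (⌊y 2 * k⌋₊ + 1 : ℕ)]) 1 = 0
      rw [h5]; simp
  · have e4 : nrm (Qm n R (((k : ℝ)⁻¹) • β k)) = nrm (Qm n R (β k)) := by
      have hk' : (k : ℝ) ≠ 0 := by exact_mod_cast hk0.ne'
      unfold nrm
      congr 1
      rw [map_smul]
      simp only [Pi.smul_apply, smul_eq_mul]
      rw [← mul_add, ← mul_add, smul_smul]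
      congr 1
      rw [mul_inv, inv_inv]
      field_simp
    simp only [Function.comp] at hk
    rw [e4] at hk
    exact hk

/-! ### Discontinuity -/

lemma dN_le1 (m m' : NN) (R : ℕ) (h : ∀ s, s < R → m'.1 s = m.1 s) :
    dN m' m ≤ (2 : ℝ) ^ (-(R : ℤ)) := by
  unfold dN
  by_cases hmm : m' = m
  · rw [dif_pos hmm]; positivity
  · rw [dif_neg hmm]
    have hex : ∃ r, m'.1 r ≠ m.1 r := by
      by_contra hc
      push Not at hc
      exact hmm (Subtype.ext (funext hc))
    apply zpow_le_zpow_right₀ (by norm_num)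
    have hq : R ≤ Nat.find hex := by
      by_contra hc
      push Not at hc
      exact Nat.find_spec hex (h _ hc)
    apply neg_le_neg
    have : (R : ℤ) ≤ (Nat.find hex : ℤ) := by exact_mod_cast hq
    have h0 : (0 : ℤ) ≤ ((min (∑ s ∈ Finset.range (Nat.find hex + 1), m'.1 s)
            (∑ s ∈ Finset.range (Nat.find hex + 1), m.1 s)).toNat : ℤ) := by positivity
    linarith

lemma dN_le2 (m : NN) (g : ℕ → ℕ) (R : ℕ) (h : ∀ s, s < R → (g s : ℕ∞) = m.1 s)
    (ht : m.1 R = ⊤) : dN (toNN g) m ≤ (2 : ℝ) ^ (-(g R : ℤ)) := by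
  unfold dN
  have hne : (toNN g).1 R ≠ m.1 R := by
    rw [ht]; exact ENat.coe_ne_top _
  have hmm : toNN g ≠ m := fun h => hne (by rw [h])
  rw [dif_neg hmm]
  have hex : ∃ r, (toNN g).1 r ≠ m.1 r := ⟨R, hne⟩
  have hq : Nat.find hex = R := by
    rw [Nat.find_eq_iff]
    exact ⟨hne, fun s hs => not_not.mpr (h s hs)⟩
  apply zpow_le_zpow_right₀ (by norm_num)
  apply neg_le_neg
  have h1 : ∑ s ∈ Finset.range (Nat.find hex + 1), m.1 s = ⊤ := by
    rw [hq, Finset.sum_range_succ, ht, add_top]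
  have h2 : ∑ s ∈ Finset.range (Nat.find hex + 1), (toNN g).1 s =
      ((∑ s ∈ Finset.range (Nat.find hex + 1), g s : ℕ) : ℕ∞) := by
    push_cast; rfl
  have h3 : min (∑ s ∈ Finset.range (Nat.find hex + 1), (toNN g).1 s)
            (∑ s ∈ Finset.range (Nat.find hex + 1), m.1 s) =
      ((∑ s ∈ Finset.range (Nat.find hex + 1), g s : ℕ) : ℕ∞) := by
    rw [h1, h2, min_eq_left le_top]
  have h4 : g R ≤ ∑ s ∈ Finset.range (Nat.find hex + 1), g s :=
    Finset.single_le_sum (f := g) (fun _ _ => Nat.zero_le _) (by rw [hq]; simp)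
  rw [h3, ENat.toNat_coe]
  have h5 : (g R : ℤ) ≤ ((∑ s ∈ Finset.range (Nat.find hex + 1), g s : ℕ) : ℤ) := by
    exact_mod_cast h4
  have h6 : (0 : ℤ) ≤ (Nat.find hex : ℤ) := by positivity
  linarith

lemma discont (m : NN) (μ : E 3) (ε : ℝ) (hε : 0 < ε)
    (h : ∀ x ∈ Set.extremePoints ℝ (DD m), ε ≤ dist x μ)
    (ha : ∀ δ > (0 : ℝ), ∃ m', dN m' m < δ ∧ ∃ p ∈ Set.extremePoints ℝ (DD m'), dist p μ < ε / 2) :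
    ¬ ∀ ε > (0 : ℝ), ∃ δ > (0 : ℝ), ∀ m' : NN, dN m' m < δ →
        Metric.hausdorffDist (Set.extremePoints ℝ (DD m'))
          (Set.extremePoints ℝ (DD m)) < ε := by
  intro hc
  obtain ⟨δ, hδ, hd⟩ := hc (ε / 2) (by linarith)
  obtain ⟨m', h1, p, hp, h2⟩ := ha δ hδ
  obtain ⟨q, hq, h3⟩ := Metric.exists_dist_lt_of_hausdorffDist_lt hp (hd m' h1)
    (Metric.hausdorffEDist_ne_top_of_nonempty_of_bounded (EP_nonempty m') (EP_nonempty m)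
      (EP_bounded m') (EP_bounded m))
  have := h q hq
  have := dist_triangle q p μ
  rw [dist_comm q p] at this
  linarith

lemma ext_eq (D : Set (E 3)) (hD : Convex ℝ D) (L0 L1 e x : E 3) (h0 : L0 ∈ D) (h1 : L1 ∈ D)
    (he : e ∈ D) (a b c : ℝ) (ha : 0 < a) (hb : 0 < b) (hc : 0 ≤ c) (hs : a + b + c = 1)
    (hx : x = a • L0 + b • L1 + c • e) (hex : x ∈ Set.extremePoints ℝ D) : L0 = x := by
  have hbc : 0 < b + c := by linarith
  have hz : (b / (b + c)) • L1 + (c / (b + c)) • e ∈ D :=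
    hD h1 he (by positivity) (by positivity) (by field_simp)
  rw [mem_extremePoints] at hex
  refine (hex.2 L0 h0 _ hz ⟨a, b + c, ha, hbc, by linarith, ?_⟩).1
  rw [hx, smul_add, smul_smul, smul_smul, mul_div_cancel₀ _ hbc.ne', mul_div_cancel₀ _ hbc.ne',
    add_assoc]

lemma no_ext (D : Set (E 3)) (hD : Convex ℝ D) (hS : D ⊆ simplex 3) (L0 L1 e : E 3) (h0 : L0 ∈ D)
    (h1 : L1 ∈ D) (he : e ∈ D) (hne : L0 ≠ L1) (p0 p1 p2 : E 3 → ℝ) (c0 : Continuous p0)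
    (c1 : Continuous p1) (h : ∀ x ∈ D, x = p0 x • L0 + p1 x • L1 + p2 x • e)
    (h2 : ∀ x ∈ D, 0 ≤ p2 x) (μ : E 3) (m0 : 0 < p0 μ) (m1 : 0 < p1 μ) :
    ∃ ε > (0 : ℝ), ∀ x ∈ Set.extremePoints ℝ D, ε ≤ dist x μ := by
  have e1 := c0.continuousAt.eventually (lt_mem_nhds m0)
  have e2 := c1.continuousAt.eventually (lt_mem_nhds m1)
  obtain ⟨ε, hε, hb⟩ := Metric.eventually_nhds_iff.mp (e1.and e2)
  refine ⟨ε, hε, fun x hx => ?_⟩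
  by_contra hc
  push Not at hc
  obtain ⟨q0, q1⟩ := hb hc
  have hxD := hx.1
  have hxe := h x hxD
  have hs : p0 x + p1 x + p2 x = 1 := by
    have s0 := ((mem_simplex _).mp (hS h0)).2
    have s1 := ((mem_simplex _).mp (hS h1)).2
    have s2 := ((mem_simplex _).mp (hS he)).2
    have s3 := ((mem_simplex _).mp (hS hxD)).2
    have hi : ∀ i, toV x i = p0 x * toV L0 i + p1 x * toV L1 i + p2 x * toV e i := by
      intro i
      have := congrArg (fun z => toV z i) hxe
      simpa only [map_add, map_smul, Pi.add_apply, Pi.smul_apply, smul_eq_mul] using this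
    rw [hi 0, hi 1, hi 2] at s3
    calc p0 x + p1 x + p2 x = p0 x * (toV L0 0 + toV L0 1 + toV L0 2) +
        p1 x * (toV L1 0 + toV L1 1 + toV L1 2) + p2 x * (toV e 0 + toV e 1 + toV e 2) := by
          rw [s0, s1, s2]; ring
      _ = 1 := by linarith
  have a1 := ext_eq D hD L0 L1 e x h0 h1 he _ _ _ q0 q1 (h2 x hxD) hs hxe hx
  have a2 := ext_eq D hD L1 L0 e x h1 h0 he _ _ _ q1 q0 (h2 x hxD) (by linarith)
    (hxe.trans (by rw [add_comm (p0 x • L0)])) hx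
  exact hne (a1.trans a2.symm)

lemma orb_e0 (n : ℕ → ℕ) (r : ℕ) (hr : 1 ≤ r) : orb n r ![1, 0, 0] 2 ≤ -1 := by
  have hC : Cminus ![1, 0, 0] := by
    refine ⟨?_, ?_, ?_⟩ <;> simp
  have h := orb2_anti n ![1, 0, 0] (fun r => (Cminus_orb r n _ hC).2.1) hr
  have h1 : orb n 1 ![1, 0, 0] 2 = -1 := by
    show orb n (0 + 1) ![1, 0, 0] 2 = -1
    rw [orb_succ', Mi_2]
    show ((n 0 : ℝ) + 1) * 0 - 1 = -1
    ring
  exact h.trans h1.le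

lemma pow_small (δ : ℝ) (hδ : 0 < δ) : ∃ R : ℕ, ∀ k : ℕ, R ≤ k → (2 : ℝ) ^ (-(k : ℤ)) < δ := by
  obtain ⟨R, hR⟩ := exists_pow_lt_of_lt_one hδ (by norm_num : (1 / 2 : ℝ) < 1)
  refine ⟨R, fun k hk => lt_of_le_of_lt ?_ hR⟩
  rw [zpow_neg, zpow_natCast, ← inv_pow, ← one_div]
  exact pow_le_pow_of_le_one (by norm_num) (by norm_num) hk

lemma case_finite (m : NN) (hm : ∃ r, m.1 r = ⊤) :
    ¬ ∀ ε > (0 : ℝ), ∃ δ > (0 : ℝ), ∀ m' : NN, dN m' m < δ →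
        Metric.hausdorffDist (Set.extremePoints ℝ (DD m'))
          (Set.extremePoints ℝ (DD m)) < ε := by
  obtain ⟨R, hR, hlt⟩ : ∃ R, m.1 R = ⊤ ∧ ∀ s, s < R → m.1 s ≠ ⊤ :=
    ⟨Nat.find hm, Nat.find_spec hm, fun s hs => Nat.find_min hm hs⟩
  set n := nn m with hn
  let e0 : V := ![1, 0, 0]
  let e1 : V := ![0, 1, 0]
  have e0p : ∀ i, 0 ≤ e0 i := by intro i; fin_cases i <;> simp [e0]
  have e1p : ∀ i, 0 ≤ e1 i := by intro i; fin_cases i <;> simp [e1]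
  have e0n : e0 ≠ 0 := fun h => by have := congrFun h 0; simp [e0] at this
  have e1n : e1 ≠ 0 := fun h => by have := congrFun h 1; simp [e1] at this
  have key : ∀ z : V, (∀ i, 0 ≤ z i) → z ≠ 0 → z 2 = 0 →
      ∃ s > (0 : ℝ), ∃ L ∈ DD m, toV L = s⁻¹ • Qm n R z := by
    intro z hz hz0 hz2
    obtain ⟨h1, h2⟩ := nrm_simplex _ (Qm_nonneg R n _ hz) (Qm_ne n R _ hz0)
    refine ⟨_, h1, nrm (Qm n R z), ⟨h2, ?_⟩, toV_nrm _⟩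
    rw [toV_nrm]
    refine Dc_of m R _ hlt (fun k hk => ?_) ?_
    · rw [map_smul]
      exact ⟨mul_nonneg (inv_nonneg.mpr h1.le) (orb_Qm_nonneg R n z hz k hk 0),
        mul_nonneg (inv_nonneg.mpr h1.le) (orb_Qm_nonneg R n z hz k hk 1)⟩
    · rw [map_smul, ← hn, orb_Qm, Pi.smul_apply, hz2, smul_zero]
  obtain ⟨s0, hs0, L0, hL0, t0⟩ := key e0 e0p e0n rfl
  obtain ⟨s1, hs1, L1, hL1, t1⟩ := key e1 e1p e1n rfl
  let e' : V := orb n R ![1, 0, 0]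
  let X : E 3 → V := fun x => orb n R (toV x)
  let c : E 3 → ℝ := fun x => X x 2 / e' 2
  let p0 : E 3 → ℝ := fun x => s0 * (X x 0 - c x * e' 0)
  let p1 : E 3 → ℝ := fun x => s1 * (X x 1 - c x * e' 1)
  have hX : ∀ i, Continuous fun x => X x i := fun i => orb_cont n R i
  have hc : Continuous c := (hX 2).div_const _
  have XL0 : X L0 = s0⁻¹ • e0 := by
    show orb n R (toV L0) = _
    rw [t0, map_smul, orb_Qm]
  have XL1 : X L1 = s1⁻¹ • e1 := by
    show orb n R (toV L1) = _
    rw [t1, map_smul, orb_Qm]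
  have hX2 : ∀ x ∈ DD m, X x 2 ≤ 0 := fun x hx => (hx.2 R hlt).2.2 hR
  have he2 : e' 2 ≤ 0 := by
    rcases Nat.eq_zero_or_pos R with h | h
    · show orb n R ![1, 0, 0] 2 ≤ 0
      rw [h]; exact le_refl (0 : ℝ)
    · have := orb_e0 n R h
      show orb n R ![1, 0, 0] 2 ≤ 0
      linarith
  have hce : ∀ x ∈ DD m, c x * e' 2 = X x 2 := by
    intro x hx
    rcases Nat.eq_zero_or_pos R with h | h
    · have h1 := hX2 x hx
      have h2 : 0 ≤ X x 2 := by
        show 0 ≤ orb n R (toV x) 2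
        rw [h]; exact ((mem_simplex x).mp hx.1).1 2
      have h3 : X x 2 = 0 := le_antisymm h1 h2
      show X x 2 / e' 2 * e' 2 = X x 2
      rw [h3]; simp
    · have h1 : e' 2 ≤ -1 := orb_e0 n R h
      exact div_mul_cancel₀ _ (by linarith)
  let μ : E 3 := (1 / 2 : ℝ) • L0 + (1 / 2 : ℝ) • L1
  have hμ : μ ∈ DD m := DD_convex m hL0 hL1 (by norm_num) (by norm_num) (by norm_num)
  have Xμ : X μ = (1 / 2 : ℝ) • s0⁻¹ • e0 + (1 / 2 : ℝ) • s1⁻¹ • e1 := by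
    rw [← XL0, ← XL1]
    show orb n R (toV ((1 / 2 : ℝ) • L0 + (1 / 2 : ℝ) • L1)) = _
    rw [map_add, map_smul, map_smul, map_add, map_smul, map_smul]
  have Xμ0 : X μ 0 = 1 / 2 * s0⁻¹ := by rw [Xμ]; simp [e0, e1]
  have Xμ1 : X μ 1 = 1 / 2 * s1⁻¹ := by rw [Xμ]; simp [e0, e1]
  have Xμ2 : X μ 2 = 0 := by rw [Xμ]; simp [e0, e1]
  have hne : L0 ≠ L1 := by
    intro h
    have h1 : X L0 0 = X L1 0 := by rw [h]
    rw [XL0, XL1] at h1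
    simp [e0, e1] at h1
    exact hs0.ne' h1
  obtain ⟨ε, hε, hno⟩ := no_ext (DD m) (DD_convex m) (fun x hx => hx.1) L0 L1 E0 hL0 hL1
    (E0_mem m) hne p0 p1 c (continuous_const.mul ((hX 0).sub (hc.mul continuous_const)))
    (continuous_const.mul ((hX 1).sub (hc.mul continuous_const)))
    (by
      intro x hx
      apply toV.injective
      rw [← Qm_orb R n (toV x), ← Qm_orb R n (toV (_ + _))]
      congr 1
      have e5 : orb n R (toV (p0 x • L0 + p1 x • L1 + c x • E0)) =
          p0 x • X L0 + p1 x • X L1 + c x • e' := by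
        simp only [map_add, map_smul, toV_E0]
        rfl
      rw [e5, XL0, XL1]
      have hh := hce x hx
      apply V_ext
      · simp [e0, e1, p0, p1]
        field_simp
        simp [X]
      · simp [e0, e1, p0, p1]
        field_simp
        simp [X]
      · simp [e0, e1, p0, p1]
        exact hh.symm)
    (fun x hx => div_nonneg_of_nonpos (hX2 x hx) he2) μ
    (by
      have : c μ = 0 := by show X μ 2 / e' 2 = 0; rw [Xμ2, zero_div]
      show 0 < s0 * (X μ 0 - c μ * e' 0)
      rw [this, Xμ0]; simp; exact mul_pos hs0 (by positivity))
    (by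
      have : c μ = 0 := by show X μ 2 / e' 2 = 0; rw [Xμ2, zero_div]
      show 0 < s1 * (X μ 1 - c μ * e' 1)
      rw [this, Xμ1]; simp; exact mul_pos hs1 (by positivity))
  refine discont m μ ε hε hno fun δ hδ => ?_
  obtain ⟨N, hN⟩ := pow_small δ hδ
  have hy : ∀ i, 0 ≤ X μ i := by
    intro i; fin_cases i
    · show 0 ≤ X μ 0
      rw [Xμ0]; positivity
    · show 0 ≤ X μ 1
      rw [Xμ1]; positivity
    · show 0 ≤ X μ 2
      rw [Xμ2]
  have h1 := rat_approx n R μ hμ.1 (X μ) hy (Qm_orb R n _).symm (ε / 2) (by linarith)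
  have hpos : 0 < X μ 0 := by rw [Xμ0]; positivity
  have h2 : ∀ᶠ k : ℕ in atTop, (N : ℝ) ≤ X μ 0 * k :=
    (tendsto_natCast_atTop_atTop.const_mul_atTop hpos).eventually_ge_atTop _
  obtain ⟨k, ⟨g, g1, g2, p, hp, hd⟩, hk⟩ := (h1.and h2).exists
  refine ⟨toNN g, ?_, p, hp, hd⟩
  refine (dN_le2 m g R (fun s hs => ?_) hR).trans_lt (hN _ ?_)
  · rw [g1 s hs]; exact ENat.coe_toNat (hlt s hs)
  · rw [g2, Xμ2]; simp
    exact Nat.le_floor hk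

lemma case_exc (m : NN) (hm : ∀ s, m.1 s ≠ ⊤) (hA : ¬ ∃ α, AI (nn m) = {α}) :
    ¬ ∀ ε > (0 : ℝ), ∃ δ > (0 : ℝ), ∀ m' : NN, dN m' m < δ →
        Metric.hausdorffDist (Set.extremePoints ℝ (DD m'))
          (Set.extremePoints ℝ (DD m)) < ε := by
  set n := nn m with hn
  obtain ⟨L0, hL0⟩ := AI_nonempty n
  obtain ⟨L1, hL1, hne⟩ : ∃ L1 ∈ AI n, L0 ≠ L1 := by
    by_contra hc
    push Not at hc
    exact hA ⟨L0, Set.eq_singleton_iff_unique_mem.mpr ⟨hL0, fun x hx => (hc x hx).symm⟩⟩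
  have hinf : ∀ N, ∃ j, N ≤ j ∧ n j ≠ 0 := by
    by_contra hc
    push Not at hc
    obtain ⟨R, hR⟩ := hc
    have hz : ∀ L ∈ AI n, orb n R (toV L) 0 = 0 ∧ orb n R (toV L) 1 = 0 := fun L hL =>
      AF_zero (fun s => n (R + s)) (fun s => hR _ (by omega)) _ (fun r i => by
        rw [← orb_add]; exact hL.2 _ _)
    exact hne (prop_of_zero n R L1 L0 hL1.1 hL0.1 (hz _ hL1).1 (hz _ hL1).2 (hz _ hL0).1
      (hz _ hL0).2)
  have lim0 := orb2_lim n _ hL0.2 hinf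
  have lim1 := orb2_lim n _ hL1.2 hinf
  have sum0 := ((mem_simplex L0).mp hL0.1).2
  have sum1 := ((mem_simplex L1).mp hL1.1).2
  have pos0 := AF_pos n _ hL0.2 (by rw [sum0]; norm_num)
  have pos1 := AF_pos n _ hL1.2 (by rw [sum1]; norm_num)
  set a := toV L0 with ha
  set b := toV L1 with hb
  have hAD : ∀ L ∈ AI n, L ∈ DD m := fun L hL => ⟨hL.1, fun r _ =>
    ⟨hL.2 r 0, hL.2 r 1, fun ht => absurd ht (hm r)⟩⟩
  have hG : a 1 * b 2 - a 2 * b 1 ≠ 0 := by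
    intro hG
    have e : b 2 • a - a 2 • b = (b 2 * a 0 - a 2 * b 0) • (![1, 0, 0] : V) := by
      apply V_ext
      · simp
      · simp; linarith
      · simp; ring
    set c := b 2 * a 0 - a 2 * b 0 with hc
    have hc0 : c = 0 := by
      have hl : Tendsto (fun r => c * orb n r ![1, 0, 0] 2) atTop (𝓝 0) := by
        have := (lim0.const_mul (b 2)).sub (lim1.const_mul (a 2))
        rw [mul_zero, mul_zero, sub_zero] at this
        refine this.congr fun r => ?_
        have h3 := congrArg (fun z => orb n r z 2) e
        simpa only [map_sub, map_smul, Pi.sub_apply, Pi.smul_apply, smul_eq_mul] using h3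
      by_contra hcn
      have h4 := (Metric.tendsto_nhds.mp hl |c| (abs_pos.mpr hcn)).and (eventually_ge_atTop 1)
      obtain ⟨r, h5, h6⟩ := h4.exists
      rw [Real.dist_eq, sub_zero, abs_mul] at h5
      have h7 := orb_e0 n r h6
      have h8 : 1 ≤ |orb n r ![1, 0, 0] 2| := by
        rw [abs_of_neg (by linarith)]; linarith
      have := mul_le_mul_of_nonneg_left h8 (abs_nonneg c)
      linarith
    rw [hc0, zero_smul, sub_eq_zero] at e
    refine hne (simplex_prop L1 L0 (a 2 / b 2) hL1.1 hL0.1 ?_)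
    rw [← ha, ← hb, div_eq_inv_mul, mul_smul, ← e, smul_smul, inv_mul_cancel₀ pos1.ne', one_smul]
  set G := a 1 * b 2 - a 2 * b 1 with hGd
  let p0 : E 3 → ℝ := fun x => (toV x 1 * b 2 - toV x 2 * b 1) / G
  let p1 : E 3 → ℝ := fun x => (a 1 * toV x 2 - a 2 * toV x 1) / G
  let p2 : E 3 → ℝ := fun x => toV x 0 - p0 x * a 0 - p1 x * b 0
  have cV : ∀ i, Continuous fun x : E 3 => toV x i := fun i => (continuous_apply i).comp toV.continuous
  have c0 : Continuous p0 :=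
    (((cV 1).mul continuous_const).sub ((cV 2).mul continuous_const)).div_const _
  have c1 : Continuous p1 :=
    ((continuous_const.mul (cV 2)).sub (continuous_const.mul (cV 1))).div_const _
  have hdec : ∀ x : E 3, toV x = p0 x • a + p1 x • b + p2 x • ![1, 0, 0] := by
    intro x
    generalize hx : toV x = v
    have q0 : p0 x = (v 1 * b 2 - v 2 * b 1) / G := by rw [← hx]
    have q1 : p1 x = (a 1 * v 2 - a 2 * v 1) / G := by rw [← hx]
    have q2 : p2 x = v 0 - p0 x * a 0 - p1 x * b 0 := by rw [← hx]
    apply V_ext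
    · simp only [Pi.add_apply, Pi.smul_apply, smul_eq_mul]
      rw [q2]; simp
    · simp only [Pi.add_apply, Pi.smul_apply, smul_eq_mul]
      rw [q0, q1]; simp
      field_simp
      rw [hGd]; ring
    · simp only [Pi.add_apply, Pi.smul_apply, smul_eq_mul]
      rw [q0, q1]; simp
      field_simp
      rw [hGd]; ring
  have hp2 : ∀ x ∈ DD m, 0 ≤ p2 x := by
    intro x hx
    by_contra hneg
    push Not at hneg
    have hcd : ∀ r, 0 ≤ orb n r (toV x) 0 ∧ 0 ≤ orb n r (toV x) 1 := fun r =>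
      ⟨(hx.2 r fun s _ => hm s).1, (hx.2 r fun s _ => hm s).2.1⟩
    have hor : ∀ r, orb n r (toV x) 2 = p0 x * orb n r a 2 + p1 x * orb n r b 2 +
        p2 x * orb n r ![1, 0, 0] 2 := by
      intro r
      have h3 := congrArg (fun z => orb n r z 2) (hdec x)
      simpa only [map_add, map_smul, Pi.add_apply, Pi.smul_apply, smul_eq_mul] using h3
    have hl : Tendsto (fun r => p0 x * orb n r a 2 + p1 x * orb n r b 2) atTop (𝓝 0) := by
      have := (lim0.const_mul (p0 x)).add (lim1.const_mul (p1 x))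
      rwa [mul_zero, mul_zero, add_zero] at this
    have hev : ∀ᶠ r in atTop, -p2 x / 2 ≤ orb n r (toV x) 2 := by
      have h4 := (Metric.tendsto_nhds.mp hl (-p2 x / 2) (by linarith)).and (eventually_ge_atTop 1)
      filter_upwards [h4] with r h5
      obtain ⟨h5, h6⟩ := h5
      rw [Real.dist_eq, sub_zero, abs_lt] at h5
      have h7 := orb_e0 n r h6
      rw [hor]
      nlinarith
    have hanti := orb2_anti n (toV x) fun r => (hcd r).2
    have hAF : toV x ∈ AF n := by
      intro r i
      fin_cases i
      · exact (hcd r).1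
      · exact (hcd r).2
      · obtain ⟨s, hs, hrs⟩ := (hev.and (eventually_ge_atTop r)).exists
        have : orb n s (toV x) 2 ≤ orb n r (toV x) 2 := hanti hrs
        show 0 ≤ orb n r (toV x) 2
        linarith
    have := ge_of_tendsto (orb2_lim n _ hAF hinf) hev
    linarith
  let μ : E 3 := (1 / 2 : ℝ) • L0 + (1 / 2 : ℝ) • L1
  have tμ : toV μ = (1 / 2 : ℝ) • a + (1 / 2 : ℝ) • b := by
    show toV ((1 / 2 : ℝ) • L0 + (1 / 2 : ℝ) • L1) = _
    rw [map_add, map_smul, map_smul]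
  have tμi : ∀ i, toV μ i = 1 / 2 * a i + 1 / 2 * b i := fun i => by rw [tμ]; rfl
  have hμ : μ ∈ AI n := by
    refine ⟨simplex_convex hL0.1 hL1.1 (by norm_num) (by norm_num) (by norm_num), fun r i => ?_⟩
    rw [tμ, map_add, map_smul, map_smul]
    exact add_nonneg (mul_nonneg (by norm_num) (hL0.2 r i)) (mul_nonneg (by norm_num) (hL1.2 r i))
  obtain ⟨ε, hε, hno⟩ := no_ext (DD m) (DD_convex m) (fun x hx => hx.1) L0 L1 E0 (hAD _ hL0)
    (hAD _ hL1) (E0_mem m) hne p0 p1 p2 c0 c1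
    (by
      intro x _
      apply toV.injective
      rw [map_add, map_add, map_smul, map_smul, map_smul, toV_E0]
      exact hdec x)
    hp2 μ
    (by
      have : p0 μ = 1 / 2 := by
        show (toV μ 1 * b 2 - toV μ 2 * b 1) / G = 1 / 2
        rw [tμi, tμi, div_eq_iff hG, hGd]; ring
      rw [this]; norm_num)
    (by
      have : p1 μ = 1 / 2 := by
        show (a 1 * toV μ 2 - a 2 * toV μ 1) / G = 1 / 2
        rw [tμi, tμi, div_eq_iff hG, hGd]; ring
      rw [this]; norm_num)
  refine discont m μ ε hε hno fun δ hδ => ?_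
  obtain ⟨R, hR⟩ := pow_small δ hδ
  obtain ⟨k, g, g1, -, p, hp, hd⟩ := (rat_approx n R μ hμ.1 (orb n R (toV μ)) (hμ.2 R)
    (Qm_orb R n _).symm (ε / 2) (by linarith)).exists
  refine ⟨toNN g, (dN_le1 m _ R fun s hs => ?_).trans_lt (hR R le_rfl), p, hp, hd⟩
  show (g s : ℕ∞) = m.1 s
  rw [g1 s hs]; exact ENat.coe_toNat (hm s)

/-- `k = 3`: the extreme point map `EP : N → C(Δ)` is discontinuous at `m`
iff `m` is of finite type or `m ∈ ℕ^ℕ` is exceptional. -/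
theorem stmt11 (m : NN) :
    (¬ ∀ ε > (0 : ℝ), ∃ δ > (0 : ℝ), ∀ m' : NN, dN m' m < δ →
        Metric.hausdorffDist (Set.extremePoints ℝ (DFN 3 m'))
          (Set.extremePoints ℝ (DFN 3 m)) < ε) ↔
      ((∃ r, m.1 r = ⊤) ∨
        ((∀ r, m.1 r ≠ ⊤) ∧ ¬ ∃ α : E 3, PhiFiber 3 (fun r => (m.1 r).toNat) = {α})) := by
  simp only [DFN_eq, fiber_eq]
  constructor
  · intro h
    by_contra hc
    push Not at hc
    obtain ⟨h1, h2⟩ := hc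
    obtain ⟨L, hL⟩ := h2 h1
    exact h fun ε hε => cont_regular m h1 L hL ε hε
  · rintro (h | ⟨h1, h2⟩)
    · exact case_finite m h
    · exact case_exc m h1 h2

end BetaDF
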